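/- If the coefficient matrix L ∈ ℂ^{(d+1)×(n+1)} has rank d+1, then (−1)^d · χ(X) ≤ deg ℛ_L, where χ(X) is the topological Euler characteristic of the arrangement complement X and deg ℛ_L is the degree of the reciprocal linear space ℛ_L ⊂ ℙ^n. -/

import Mathlib

open scoped BigOperators
noncomputable section

namespace ScatteringPaper

open CategoryTheory AlgebraicTopology

/- ## Topological Euler characteristic via rational singular homology -/

/-- The singular chain complex of a topological space, with rational coefficients. -/
def singularChainComplex (X : Type) [TopologicalSpace X] : ChainComplex (ModuleCat ℚ) ℕ :=
  (alternatingFaceMapComplex (ModuleCat ℚ)).obj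
    (((SimplicialObject.whiskering _ _).obj (ModuleCat.free ℚ)).obj (TopCat.toSSet.obj (TopCat.of X)))

/-- The `q`-th (rational) Betti number of a topological space. -/
def betti (X : Type) [TopologicalSpace X] (q : ℕ) : ℕ :=
  Module.finrank ℚ ((singularChainComplex X).homology q)

/-- The topological Euler characteristic, as the alternating sum of Betti numbers. -/
def eulerChar (X : Type) [TopologicalSpace X] : ℤ :=
  ∑ᶠ q : ℕ, (-1 : ℤ) ^ q * (betti X q : ℤ)

variable {d : ℕ} {ι : Type} [Fintype ι] [DecidableEq ι]

/- ## Hyperplane arrangements: `(ℓ_i(x))_i = (1, x_1, …, x_d) · L` -/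

/-- Value of the affine-linear form encoded by column `i` of `L`. -/
def ell (K : Type) [Field K] (L : Matrix (Fin (d+1)) ι K) (x : Fin d → K) (i : ι) : K :=
  L 0 i + ∑ j : Fin d, x j * L j.succ i

/-- The complement `X = ℂ^d ∖ 𝒜` of the arrangement `𝒜 = V(∏ ℓ_i)`. -/
def complementX (L : Matrix (Fin (d+1)) ι ℂ) : Set (Fin d → ℂ) := {x | ∀ i, ell ℂ L x i ≠ 0}

/-- `x ∈ X` is a solution of the scattering equations
`∂ℒ_u/∂x_k = ∑_i u_i a_{ki}/ℓ_i(x) = 0`, `k = 1, …, d`. -/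
def IsSol (L : Matrix (Fin (d+1)) ι ℂ) (u : ι → ℂ) (x : Fin d → ℂ) : Prop :=
  x ∈ complementX L ∧ ∀ k : Fin d, ∑ i : ι, u i * L k.succ i / ell ℂ L x i = 0

/-- An arrangement is essential if some subset of its hyperplanes meets in a single point. -/
def IsEssential (L : Matrix (Fin (d+1)) ι ℂ) : Prop :=
  ∃ (S : Set ι) (x₀ : Fin d → ℂ), {x : Fin d → ℂ | ∀ i ∈ S, ell ℂ L x i = 0} = {x₀}

/-- `P u` holds for all `u` outside a proper algebraic subset (i.e. for generic `u`). -/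
def Generically {σ : Type} [Fintype σ] [DecidableEq σ] (P : (σ → ℂ) → Prop) : Prop :=
  ∃ g : MvPolynomial σ ℂ, g ≠ 0 ∧ ∀ u : σ → ℂ, MvPolynomial.eval u g ≠ 0 → P u

/- ## Matroid data of the columns of `L` -/

/-- Rank of the set `I` of columns of `L` (the matroid rank in `M(L)`). -/
def rkL (K : Type) [Field K] (L : Matrix (Fin (d+1)) ι K) (I : Set ι) : ℕ :=
  Module.finrank K (Submodule.span K ((fun i => fun r => L r i) '' I))

/-- Rank of the set `I` of columns of `A^⊤` (`L` with its first row deleted). -/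
def rkA (K : Type) [Field K] (L : Matrix (Fin (d+1)) ι K) (I : Set ι) : ℕ :=
  Module.finrank K (Submodule.span K ((fun i => fun k : Fin d => L k.succ i) '' I))

/-- `I` is a flat of the matroid `M(L)`. -/
def IsFlat (K : Type) [Field K] (L : Matrix (Fin (d+1)) ι K) (I : Set ι) : Prop :=
  ∀ i ∉ I, rkL K L I < rkL K L (insert i I)

/-- `C` is a circuit of `M(L)`: a minimal linearly dependent set of columns. -/
def IsCircuit (K : Type) [Field K] (L : Matrix (Fin (d+1)) ι K) (C : Finset ι) : Prop :=
  (¬ LinearIndependent K (fun i : {a // a ∈ C} => fun r => L r i.1)) ∧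
  ∀ D : Finset ι, D ⊂ C → LinearIndependent K (fun i : {a // a ∈ D} => fun r => L r i.1)

/-- `M(L)` is connected: there is no separation into two nonempty parts with additive rank. -/
def MatroidConnected (K : Type) [Field K] (L : Matrix (Fin (d+1)) ι K) : Prop :=
  ∀ S : Set ι, S.Nonempty → Sᶜ.Nonempty → rkL K L S + rkL K L Sᶜ ≠ rkL K L Set.univ

/- ## The reciprocal linear space -/

/-- Zariski closure of a subset of affine space `K^ι`. -/
def zarClosure (K : Type) [Field K] (S : Set (ι → K)) : Set (ι → K) :=
  {v | ∀ f : MvPolynomial ι K, (∀ w ∈ S, MvPolynomial.eval w f = 0) → MvPolynomial.eval v f = 0}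

/-- The affine cone over the image of `φ : x ↦ (ℓ_0(x)⁻¹ : ⋯ : ℓ_n(x)⁻¹)`. -/
def coneImage (L : Matrix (Fin (d+1)) ι ℂ) : Set (ι → ℂ) :=
  {v | ∃ (c : ℂ) (x : Fin d → ℂ), x ∈ complementX L ∧ v = fun i => c / ell ℂ L x i}

/-- The vanishing ideal of a subset of affine space. -/
def vanishingIdeal (K : Type) [Field K] (S : Set (ι → K)) : Ideal (MvPolynomial ι K) where
  carrier := {f | ∀ v ∈ S, MvPolynomial.eval v f = 0}
  add_mem' := by
    intro a b ha hb v hv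
    simp [map_add, ha v hv, hb v hv]
  zero_mem' := by intro v hv; simp
  smul_mem' := by
    intro c f hf v hv
    simp [smul_eq_mul, map_mul, hf v hv]

/-- Projective space `ℙ^n = ℙ(ℂ^ι)`. -/
abbrev Pn (ι : Type) [Fintype ι] := Projectivization ℂ (ι → ℂ)

/-- The reciprocal linear space `ℛ_L ⊂ ℙ^n`, the Zariski closure of `im φ`. -/
def RL (L : Matrix (Fin (d+1)) ι ℂ) : Set (Pn ι) :=
  {p | p.rep ∈ zarClosure ℂ (coneImage L)}

/-- The linear space `𝕃_u = {y : A^⊤ diag(u) y = 0} ⊂ ℙ^n`. -/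
def LuSet (L : Matrix (Fin (d+1)) ι ℂ) (u : ι → ℂ) : Set (Pn ι) :=
  {p | ∀ k : Fin d, ∑ i : ι, L k.succ i * u i * p.rep i = 0}

/-- The torus orbit `U_I = {y ∈ ℙ^n : y_i ≠ 0 ⇔ i ∈ I}`. -/
def Ustratum (I : Set ι) : Set (Pn ι) := {p : Pn ι | ∀ i : ι, p.rep i ≠ 0 ↔ i ∈ I}

/-- `p = φ(x)` for the map `φ : x ↦ (ℓ_0(x)⁻¹ : ⋯ : ℓ_n(x)⁻¹)`. -/
def PhiRel (L : Matrix (Fin (d+1)) ι ℂ) (x : Fin d → ℂ) (p : Pn ι) : Prop :=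
  ∃ hv : (fun i => (ell ℂ L x i)⁻¹) ≠ 0, p = Projectivization.mk ℂ (fun i => (ell ℂ L x i)⁻¹) hv

/-- The image of `φ` in `ℙ^n`. -/
def imPhi (L : Matrix (Fin (d+1)) ι ℂ) : Set (Pn ι) :=
  {p | ∃ x ∈ complementX L, PhiRel L x p}

/-- Complement of the subarrangement `𝒜_I`. -/
def subComplement (L : Matrix (Fin (d+1)) ι ℂ) (I : Set ι) : Set (Fin d → ℂ) :=
  {x | ∀ i ∈ I, ell ℂ L x i ≠ 0}

/-- The affine cone over the image of the reciprocal map of the subarrangement indexed by `I`,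
embedded in the coordinate subspace `{y_i = 0, i ∉ I}`. -/
def coneImageSub (L : Matrix (Fin (d+1)) ι ℂ) (I : Set ι) : Set (ι → ℂ) :=
  {v | ∃ (c : ℂ) (x : Fin d → ℂ), x ∈ subComplement L I ∧
      v = I.indicator (fun i => c / ell ℂ L x i)}

/-- The reciprocal linear space `ℛ_{L_I}` of the submatrix `L_I`, embedded in `ℙ^n`. -/
def RLsub (L : Matrix (Fin (d+1)) ι ℂ) (I : Set ι) : Set (Pn ι) :=
  {p | p.rep ∈ zarClosure ℂ (coneImageSub L I)}

/-- The open stratum `ℛ_{L_I}^∘ = ℛ_{L_I} ∩ U_I`. -/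
def RLsubOpen (L : Matrix (Fin (d+1)) ι ℂ) (I : Set ι) : Set (Pn ι) :=
  RLsub L I ∩ Ustratum I

/- ## The very affine variety `X_I = (ℂ^d ∖ 𝒜_I)/K_I` -/

/-- Quotient of `ℂ^d ∖ 𝒜_I` by translation by the left kernel `K_I` of `A_I^⊤`:
two points are identified iff `A_I^⊤` takes the same values on them. -/
def XIsetoid (L : Matrix (Fin (d+1)) ι ℂ) (I : Set ι) : Setoid ↥(subComplement L I) where
  r x y := ∀ i ∈ I, ∑ k : Fin d, (x : Fin d → ℂ) k * L k.succ i
      = ∑ k : Fin d, (y : Fin d → ℂ) k * L k.succ i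
  iseqv := ⟨fun _ _ _ => rfl, fun h i hi => (h i hi).symm, fun h1 h2 i hi => (h1 i hi).trans (h2 i hi)⟩

/-- The very affine variety `X_I = (ℂ^d ∖ 𝒜_I)/K_I`. -/
def XI (L : Matrix (Fin (d+1)) ι ℂ) (I : Set ι) : Type := Quotient (XIsetoid L I)

instance (L : Matrix (Fin (d+1)) ι ℂ) (I : Set ι) : TopologicalSpace (XI L I) :=
  instTopologicalSpaceQuotient

/-- The complement of the arrangement, over a general field `K`. -/
def complementK (K : Type) [Field K] (L : Matrix (Fin (d+1)) ι K) : Set (Fin d → K) :=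
  {x | ∀ i, ell K L x i ≠ 0}

/-- The affine cone over the image of the reciprocal map, over a general field `K`. -/
def coneImageK (K : Type) [Field K] (L : Matrix (Fin (d+1)) ι K) : Set (ι → K) :=
  {v | ∃ (c : K) (x : Fin d → K), x ∈ complementK K L ∧ v = fun i => c / ell K L x i}

/- ## Hilbert functions, degree, Hilbert regularity -/

/-- The Hilbert function of the graded algebra `K[y]/I`:
`q ↦ dim_K (K[y]/I)_q`. -/
def hilb (K : Type) [Field K] (I : Ideal (MvPolynomial ι K)) (q : ℕ) : ℕ :=
  Module.finrank K ((MvPolynomial.homogeneousSubmodule ι K q).map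
    (Ideal.Quotient.mkₐ K I).toLinearMap)

/-- `k` is the degree of the `d`-dimensional projective variety with homogeneous
coordinate ring `K[y]/I`: the Hilbert polynomial has degree `d` and leading
coefficient `k/d!`. -/
def IsProjDegree (K : Type) [Field K] (I : Ideal (MvPolynomial ι K)) (d k : ℕ) : Prop :=
  ∃ P : Polynomial ℚ, (∃ N : ℕ, ∀ q : ℕ, N ≤ q → Polynomial.eval (q : ℚ) P = hilb K I q) ∧
    P.degree = (d : WithBot ℕ) ∧ P.leadingCoeff = (k : ℚ) / (Nat.factorial d : ℚ)

/-- The Hilbert function, extended by `0` to negative integers. -/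
def HFZ (K : Type) [Field K] (I : Ideal (MvPolynomial ι K)) (q : ℤ) : ℕ :=
  if 0 ≤ q then hilb K I q.toNat else 0

/-- The Hilbert regularity: the smallest degree from which the Hilbert function
agrees with a (necessarily unique) polynomial. -/
def HReg (K : Type) [Field K] (I : Ideal (MvPolynomial ι K)) : ℤ :=
  sInf {i : ℤ | ∃ P : Polynomial ℚ, ∀ q : ℤ, i ≤ q → Polynomial.eval (q : ℚ) P = HFZ K I q}

/-! ### Euler characteristics of chain complexes -/

/-- `K` has finite total homology and Euler characteristic `x`. -/
def HasChi (K : ChainComplex (ModuleCat.{0} ℚ) ℕ) (x : ℤ) : Prop :=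
  (∀ n, Module.Finite ℚ (K.homology n)) ∧
    ∃ N, ∀ M, N ≤ M → Module.finrank ℚ (K.homology M) = 0 ∧
      ∑ n ∈ Finset.range M, (-1 : ℤ) ^ n * (Module.finrank ℚ (K.homology n) : ℤ) = x

/-- Existence of an Euler characteristic from boundedness. -/
lemma HasChi.of_bdd (K : ChainComplex (ModuleCat.{0} ℚ) ℕ)
    (h1 : ∀ n, Module.Finite ℚ (K.homology n)) (N : ℕ)
    (h2 : ∀ M, N ≤ M → Module.finrank ℚ (K.homology M) = 0) :
    HasChi K (∑ n ∈ Finset.range N, (-1 : ℤ) ^ n * (Module.finrank ℚ (K.homology n) : ℤ)) := by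
  refine ⟨h1, N, fun M hM => ⟨h2 M hM, ?_⟩⟩
  induction M, hM using Nat.le_induction with
  | base => rfl
  | succ M hM ih => rw [Finset.sum_range_succ, ih, h2 M hM]; simp

lemma HasChi.unique {K : ChainComplex (ModuleCat.{0} ℚ) ℕ} {x y : ℤ}
    (h1 : HasChi K x) (h2 : HasChi K y) : x = y := by
  obtain ⟨-, N, hN⟩ := h1
  obtain ⟨-, M, hM⟩ := h2
  rw [← (hN (max N M) (le_max_left _ _)).2, (hM (max N M) (le_max_right _ _)).2]

lemma HasChi.of_homology_iso {K K' : ChainComplex (ModuleCat.{0} ℚ) ℕ} {x : ℤ}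
    (e : ∀ n, K.homology n ≅ K'.homology n) (h : HasChi K x) : HasChi K' x := by
  obtain ⟨h1, N, hN⟩ := h
  have hr : ∀ n, Module.finrank ℚ (K'.homology n) = Module.finrank ℚ (K.homology n) :=
    fun n => (e n).toLinearEquiv.finrank_eq.symm
  refine ⟨fun n => ?_, N, fun M hM => ?_⟩
  · have := h1 n
    exact Module.Finite.equiv (e n).toLinearEquiv
  · simp only [hr]
    exact hN M hM

lemma HasChi.eulerChar_eq {X : Type} [TopologicalSpace X] {x : ℤ}
    (h : HasChi (singularChainComplex X) x) : eulerChar X = x := by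
  obtain ⟨-, N, hN⟩ := h
  rw [← (hN N le_rfl).2, eulerChar]
  refine finsum_eq_sum_of_support_subset _ ?_
  intro n hn
  rw [Function.mem_support] at hn
  by_contra hc
  apply hn
  have : N ≤ n := by simpa using hc
  rw [betti, (hN n this).1]
  simp

/-- The numerical core of additivity of Euler characteristics. -/
lemma alternating_sum_of_ranks (a b c f g e : ℕ → ℤ)
    (hb : ∀ n, b n = f n + g n) (ha : ∀ n, a n = e (n + 1) + f n)
    (hc : ∀ n, c (n + 1) = g (n + 1) + e (n + 1)) (hc0 : c 0 = g 0) (N : ℕ) :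
    ∑ n ∈ Finset.range (N + 1), (-1 : ℤ) ^ n * b n + (-1) ^ N * e (N + 1) =
      ∑ n ∈ Finset.range (N + 1), (-1 : ℤ) ^ n * a n +
      ∑ n ∈ Finset.range (N + 1), (-1 : ℤ) ^ n * c n := by
  induction N with
  | zero => simp [hb, ha, hc0]; ring
  | succ N ih =>
    rw [Finset.sum_range_succ, Finset.sum_range_succ (fun n => (-1 : ℤ) ^ n * a n) (N + 1),
      Finset.sum_range_succ (fun n => (-1 : ℤ) ^ n * c n) (N + 1), hb, ha, hc]
    have e1 : (-1 : ℤ) ^ (N + 1) = - (-1) ^ N := by ring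
    rw [e1]
    linarith

section LES


abbrev hf (S : ShortComplex (ChainComplex (ModuleCat.{0} ℚ) ℕ)) (n : ℕ) : S.X₁.homology n →ₗ[ℚ] S.X₂.homology n :=
  (HomologicalComplex.homologyMap S.f n).hom
abbrev hg (S : ShortComplex (ChainComplex (ModuleCat.{0} ℚ) ℕ)) (n : ℕ) : S.X₂.homology n →ₗ[ℚ] S.X₃.homology n :=
  (HomologicalComplex.homologyMap S.g n).hom
abbrev hd (S : ShortComplex (ChainComplex (ModuleCat.{0} ℚ) ℕ)) (hS : S.ShortExact) (n : ℕ) : S.X₃.homology (n + 1) →ₗ[ℚ] S.X₁.homology n :=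
  (hS.δ (n + 1) n rfl).hom

lemma les2 (S : ShortComplex (ChainComplex (ModuleCat.{0} ℚ) ℕ)) (hS : S.ShortExact) (n : ℕ) : LinearMap.range (hf S n) = LinearMap.ker (hg S n) :=
  (hS.homology_exact₂ n).moduleCat_range_eq_ker
lemma les1 (S : ShortComplex (ChainComplex (ModuleCat.{0} ℚ) ℕ)) (hS : S.ShortExact) (n : ℕ) : LinearMap.range (hd S hS n) = LinearMap.ker (hf S n) :=
  (hS.homology_exact₁ (n+1) n rfl).moduleCat_range_eq_ker
lemma les3 (S : ShortComplex (ChainComplex (ModuleCat.{0} ℚ) ℕ)) (hS : S.ShortExact) (n : ℕ) : LinearMap.range (hg S (n+1)) = LinearMap.ker (hd S hS n) :=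
  (hS.homology_exact₃ (n+1) n rfl).moduleCat_range_eq_ker
lemma les0 (S : ShortComplex (ChainComplex (ModuleCat.{0} ℚ) ℕ)) (hS : S.ShortExact) : LinearMap.range (hg S 0) = ⊤ := by
  have := hS.epi_g
  rw [LinearMap.range_eq_top]
  have : Epi (HomologicalComplex.homologyMap S.g 0) := by
    have h1 : HomologicalComplex.homologyMap S.g 0 ≫ S.X₃.homologyι 0 =
      S.X₂.homologyι 0 ≫ HomologicalComplex.opcyclesMap S.g 0 := by simp
    have : Epi (S.g.f 0) := inferInstance
    have : Epi (HomologicalComplex.opcyclesMap S.g 0) := inferInstance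
    have : Epi (S.X₂.homologyι 0 ≫ HomologicalComplex.opcyclesMap S.g 0) := inferInstance
    rw [← h1] at this
    have h2 : HomologicalComplex.homologyMap S.g 0 =
        (HomologicalComplex.homologyMap S.g 0 ≫ S.X₃.homologyι 0) ≫ inv (S.X₃.homologyι 0) := by
      rw [Category.assoc, IsIso.hom_inv_id, Category.comp_id]
    rw [h2]
    infer_instance
  exact (ModuleCat.epi_iff_surjective _).1 this

lemma les_chi (S : ShortComplex (ChainComplex (ModuleCat.{0} ℚ) ℕ)) (hS : S.ShortExact) (h1 : ∀ n, Module.Finite ℚ (S.X₁.homology n))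
    (h2 : ∀ n, Module.Finite ℚ (S.X₂.homology n))
    (h3 : ∀ n, Module.Finite ℚ (S.X₃.homology n)) (N : ℕ)
    (hN : Module.finrank ℚ (S.X₃.homology (N + 1)) = 0) :
    ∑ n ∈ Finset.range (N + 1), (-1 : ℤ) ^ n * (Module.finrank ℚ (S.X₂.homology n) : ℤ) =
    ∑ n ∈ Finset.range (N + 1), (-1 : ℤ) ^ n * (Module.finrank ℚ (S.X₁.homology n) : ℤ) +
    ∑ n ∈ Finset.range (N + 1), (-1 : ℤ) ^ n * (Module.finrank ℚ (S.X₃.homology n) : ℤ) := by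
  have key := alternating_sum_of_ranks
    (fun n => (Module.finrank ℚ (S.X₁.homology n) : ℤ))
    (fun n => (Module.finrank ℚ (S.X₂.homology n) : ℤ))
    (fun n => (Module.finrank ℚ (S.X₃.homology n) : ℤ))
    (fun n => (Module.finrank ℚ (LinearMap.range (hf S n)) : ℤ))
    (fun n => (Module.finrank ℚ (LinearMap.range (hg S n)) : ℤ))
    (fun n => match n with
      | 0 => 0
      | n + 1 => (Module.finrank ℚ (LinearMap.range (hd S hS n)) : ℤ))
    (fun n => by
      have := LinearMap.finrank_range_add_finrank_ker (hg S n)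
      rw [← les2 S hS n] at this
      push_cast [← this]; ring)
    (fun n => by
      have := LinearMap.finrank_range_add_finrank_ker (hf S n)
      rw [← les1 S hS n] at this
      push_cast [← this]; ring)
    (fun n => by
      have := LinearMap.finrank_range_add_finrank_ker (hd S hS n)
      rw [← les3 S hS n] at this
      push_cast [← this]; ring)
    (by
      rw [les0 S hS, finrank_top]) N
  have hz : Module.finrank ℚ (LinearMap.range (hd S hS N)) = 0 := by
    have := LinearMap.finrank_range_le (hd S hS N)
    omega
  simp only [hz] at key
  simpa using key

/-- finiteness in the middle of an exact sequence -/
lemma finite_mid {A B C : Type} [AddCommGroup A] [AddCommGroup B] [AddCommGroup C]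
    [Module ℚ A] [Module ℚ B] [Module ℚ C] (f : A →ₗ[ℚ] B) (g : B →ₗ[ℚ] C)
    (h : LinearMap.range f = LinearMap.ker g) [Module.Finite ℚ A] [Module.Finite ℚ C] :
    Module.Finite ℚ B := by
  have : Module.Finite ℚ (LinearMap.ker g) := by rw [← h]; infer_instance
  have : Module.Finite ℚ (LinearMap.range g) := inferInstance
  have : Module.Finite ℚ (B ⧸ LinearMap.ker g) := Module.Finite.equiv g.quotKerEquivRange.symm
  exact Module.Finite.of_submodule_quotient (LinearMap.ker g)

lemma finrank_mid {A B C : Type} [AddCommGroup A] [AddCommGroup B] [AddCommGroup C]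
    [Module ℚ A] [Module ℚ B] [Module ℚ C] (f : A →ₗ[ℚ] B) (g : B →ₗ[ℚ] C)
    (h : LinearMap.range f = LinearMap.ker g) [Module.Finite ℚ A] [Module.Finite ℚ C]
    (ha : Module.finrank ℚ A = 0) (hc : Module.finrank ℚ C = 0) :
    Module.finrank ℚ B = 0 := by
  have := finite_mid f g h
  have h1 := LinearMap.finrank_range_add_finrank_ker g
  rw [← h] at h1
  have h2 := LinearMap.finrank_range_le f
  have h3 : Module.finrank ℚ (LinearMap.range g) ≤ Module.finrank ℚ C :=
    Submodule.finrank_le _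
  omega

lemma HasChi.mid (S : ShortComplex (ChainComplex (ModuleCat.{0} ℚ) ℕ)) (hS : S.ShortExact) {a c : ℤ} (h1 : HasChi S.X₁ a) (h3 : HasChi S.X₃ c) :
    HasChi S.X₂ (a + c) := by
  obtain ⟨f1, N1, z1⟩ := h1
  obtain ⟨f3, N3, z3⟩ := h3
  have f2 : ∀ n, Module.Finite ℚ (S.X₂.homology n) := fun n => by
    have := f1 n; have := f3 n
    exact finite_mid _ _ (les2 S hS n)
  have z2 : ∀ n, max N1 N3 ≤ n → Module.finrank ℚ (S.X₂.homology n) = 0 := fun n hn => by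
    have := f1 n; have := f3 n
    exact finrank_mid _ _ (les2 S hS n) (z1 n (by omega)).1 (z3 n (by omega)).1
  refine ⟨f2, max N1 N3 + 1, fun M hM => ⟨z2 M (by omega), ?_⟩⟩
  obtain ⟨M, rfl⟩ : ∃ k, M = k + 1 := ⟨M - 1, by omega⟩
  rw [les_chi S hS f1 f2 f3 M (z3 _ (by omega)).1,
    (z1 _ (by omega)).2, (z3 _ (by omega)).2]

lemma HasChi.left (S : ShortComplex (ChainComplex (ModuleCat.{0} ℚ) ℕ)) (hS : S.ShortExact) {b c : ℤ} (h2 : HasChi S.X₂ b) (h3 : HasChi S.X₃ c) :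
    HasChi S.X₁ (b - c) := by
  obtain ⟨f2, N2, z2⟩ := h2
  obtain ⟨f3, N3, z3⟩ := h3
  have f1 : ∀ n, Module.Finite ℚ (S.X₁.homology n) := fun n => by
    have := f2 n; have := f3 (n+1)
    exact finite_mid _ _ (les1 S hS n)
  have z1 : ∀ n, max N2 N3 ≤ n → Module.finrank ℚ (S.X₁.homology n) = 0 := fun n hn => by
    have := f2 n; have := f3 (n+1)
    exact finrank_mid _ _ (les1 S hS n) (z3 (n+1) (by omega)).1 (z2 n (by omega)).1
  refine ⟨f1, max N2 N3 + 1, fun M hM => ⟨z1 M (by omega), ?_⟩⟩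
  obtain ⟨M, rfl⟩ : ∃ k, M = k + 1 := ⟨M - 1, by omega⟩
  have := les_chi S hS f1 f2 f3 M (z3 _ (by omega)).1
  rw [(z2 _ (by omega)).2, (z3 _ (by omega)).2] at this
  linarith

lemma HasChi.right (S : ShortComplex (ChainComplex (ModuleCat.{0} ℚ) ℕ)) (hS : S.ShortExact) {a b : ℤ} (h1 : HasChi S.X₁ a) (h2 : HasChi S.X₂ b) :
    HasChi S.X₃ (b - a) := by
  obtain ⟨f2, N2, z2⟩ := h2
  obtain ⟨f1, N1, z1⟩ := h1
  have f3 : ∀ n, Module.Finite ℚ (S.X₃.homology n) := fun n => by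
    cases n with
    | zero =>
      have := f2 0
      exact Module.Finite.of_surjective (hg S 0) (LinearMap.range_eq_top.1 (les0 S hS))
    | succ n =>
      have := f2 (n+1); have := f1 n
      exact finite_mid _ _ (les3 S hS n)
  have z3 : ∀ n, max N2 N1 + 1 ≤ n → Module.finrank ℚ (S.X₃.homology n) = 0 := fun n hn => by
    obtain ⟨n, rfl⟩ : ∃ k, n = k + 1 := ⟨n - 1, by omega⟩
    have := f2 (n+1); have := f1 n
    exact finrank_mid _ _ (les3 S hS n) (z2 (n+1) (by omega)).1 (z1 n (by omega)).1
  refine ⟨f3, max N2 N1 + 1, fun M hM => ⟨z3 M (by omega), ?_⟩⟩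
  obtain ⟨M, rfl⟩ : ∃ k, M = k + 1 := ⟨M - 1, by omega⟩
  have := les_chi S hS f1 f2 f3 M (z3 _ (by omega))
  rw [(z2 _ (by omega)).2, (z1 _ (by omega)).2] at this
  linarith

end LES

/-! ### Homotopy invariance -/

/-- The rational chain complex of a simplicial set. -/
abbrev FC : SSet.{0} ⥤ ChainComplex (ModuleCat.{0} ℚ) ℕ :=
  ((SimplicialObject.whiskering _ _).obj (ModuleCat.free ℚ)) ⋙
    alternatingFaceMapComplex (ModuleCat.{0} ℚ)

lemma singularChainComplex_eq (X : Type) [TopologicalSpace X] :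
    singularChainComplex X = FC.obj (TopCat.toSSet.obj (TopCat.of X)) := rfl

/-- The space `X` has finite total homology and Euler characteristic `x`. -/
def HC (X : Type) [TopologicalSpace X] (x : ℤ) : Prop := HasChi (singularChainComplex X) x

/-- Homotopy of chain maps. -/
def chainHomotopyOfHomotopy {X Y : Type} [TopologicalSpace X] [TopologicalSpace Y]
    {f g : C(X, Y)} (H : f.Homotopy g) :
    Homotopy (FC.map (TopCat.toSSet.map (TopCat.ofHom f)))
      (FC.map (TopCat.toSSet.map (TopCat.ofHom g))) :=
  SimplicialObject.Homotopy.toChainHomotopy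
    (SimplicialObject.Homotopy.whiskerRight
      (SSet.Homotopy.toSimplicialObjectHomotopy
        (TopCat.Homotopy.toSSet (f := TopCat.ofHom f) (g := TopCat.ofHom g) H)) (ModuleCat.free ℚ))

def homologyIsoOfHomotopyEquiv {X Y : Type} [TopologicalSpace X] [TopologicalSpace Y]
    (e : ContinuousMap.HomotopyEquiv X Y) (n : ℕ) :
    (singularChainComplex X).homology n ≅ (singularChainComplex Y).homology n where
  hom := HomologicalComplex.homologyMap (FC.map (TopCat.toSSet.map (TopCat.ofHom e.toFun))) n
  inv := HomologicalComplex.homologyMap (FC.map (TopCat.toSSet.map (TopCat.ofHom e.invFun))) n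
  hom_inv_id := by
    obtain ⟨H⟩ := e.left_inv
    have := (chainHomotopyOfHomotopy H).homologyMap_eq n
    rw [TopCat.ofHom_comp, Functor.map_comp, Functor.map_comp,
      HomologicalComplex.homologyMap_comp] at this
    refine this.trans ?_
    rw [← HomologicalComplex.homologyMap_id]
    congr 1
    exact (congrArg FC.map (TopCat.toSSet.map_id _)).trans (FC.map_id _)
  inv_hom_id := by
    obtain ⟨H⟩ := e.right_inv
    have := (chainHomotopyOfHomotopy H).homologyMap_eq n
    rw [TopCat.ofHom_comp, Functor.map_comp, Functor.map_comp,
      HomologicalComplex.homologyMap_comp] at this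
    refine this.trans ?_
    rw [← HomologicalComplex.homologyMap_id]
    congr 1
    exact (congrArg FC.map (TopCat.toSSet.map_id _)).trans (FC.map_id _)

lemma HC.of_hequiv {X Y : Type} [TopologicalSpace X] [TopologicalSpace Y]
    (e : ContinuousMap.HomotopyEquiv X Y) {x : ℤ} (h : HC X x) : HC Y x :=
  HasChi.of_homology_iso (homologyIsoOfHomotopyEquiv e) h

lemma HC.of_homeo {X Y : Type} [TopologicalSpace X] [TopologicalSpace Y]
    (e : X ≃ₜ Y) {x : ℤ} (h : HC X x) : HC Y x :=
  h.of_hequiv e.toHomotopyEquiv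

/-! ### Combinatorial barycentric subdivision -/

/-- Chains on tuples of points. -/
abbrev TC (K : Type) (n : ℕ) := (Fin n → K) →₀ ℚ

/-- Boundary. -/
def bd (K : Type) (n : ℕ) : TC K (n + 1) →ₗ[ℚ] TC K n :=
  Finsupp.linearCombination ℚ
    (fun v : Fin (n + 1) → K => ∑ i : Fin (n + 1),
      (-1 : ℚ) ^ (i : ℕ) • (Finsupp.single (v ∘ i.succAbove) (1 : ℚ) : TC K n))

/-- Cone operator. -/
def cone {K : Type} (b : K) (n : ℕ) : TC K n →ₗ[ℚ] TC K (n + 1) :=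
  Finsupp.lmapDomain ℚ ℚ (fun v : Fin n → K => (Fin.cons b v : Fin (n + 1) → K))

lemma bd_single {K : Type} {n : ℕ} (v : Fin (n + 1) → K) :
    bd K n (Finsupp.single v 1) = ∑ i : Fin (n + 1),
      (-1 : ℚ) ^ (i : ℕ) • (Finsupp.single (v ∘ i.succAbove) (1 : ℚ) : TC K n) := by
  simp [bd]

lemma cone_single {K : Type} (b : K) {n : ℕ} (v : Fin n → K) (c : ℚ) :
    cone b n (Finsupp.single v c) = Finsupp.single (Fin.cons b v : Fin (n + 1) → K) c := by
  simp [cone]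

lemma cons_comp_succ_succAbove {K : Type} (b : K) {n : ℕ} (v : Fin (n + 1) → K)
    (i : Fin (n + 1)) :
    (Fin.cons b v : Fin (n + 2) → K) ∘ i.succ.succAbove =
      (Fin.cons b (v ∘ i.succAbove) : Fin (n + 1) → K) := by
  funext j
  refine Fin.cases ?_ (fun j => ?_) j
  · simp
  · simp

lemma cons_comp_zero_succAbove {K : Type} (b : K) {n : ℕ} (v : Fin n → K) :
    (Fin.cons b v : Fin (n + 1) → K) ∘ (0 : Fin (n + 1)).succAbove = v := by
  funext j
  simp

lemma bd_cone {K : Type} (b : K) {n : ℕ} (c : TC K (n + 1)) :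
    bd K (n + 1) (cone b (n + 1) c) = c - cone b n (bd K n c) := by
  suffices h : bd K (n + 1) ∘ₗ cone b (n + 1) = LinearMap.id - cone b n ∘ₗ bd K n from
    LinearMap.congr_fun h c
  apply Finsupp.lhom_ext'
  intro v
  apply LinearMap.ext_ring
  simp only [LinearMap.comp_apply, Finsupp.lsingle_apply, LinearMap.sub_apply, LinearMap.id_apply]
  rw [cone_single, bd_single, bd_single, Fin.sum_univ_succ, map_sum, sub_eq_add_neg,
    ← Finset.sum_neg_distrib]
  congr 1
  · rw [cons_comp_zero_succAbove]; simp
  · refine Finset.sum_congr rfl fun i _ => ?_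
    rw [map_smul, cone_single, cons_comp_succ_succAbove, Fin.val_succ, pow_succ]
    simp

lemma bd_cone_zero {K : Type} (b : K) (c : TC K 0) :
    bd K 0 (cone b 0 c) = c := by
  suffices h : bd K 0 ∘ₗ cone b 0 = LinearMap.id from
    LinearMap.congr_fun h c
  apply Finsupp.lhom_ext'
  intro v
  apply LinearMap.ext_ring
  simp only [LinearMap.comp_apply, Finsupp.lsingle_apply, LinearMap.id_apply]
  rw [cone_single, bd_single, Fin.sum_univ_succ, cons_comp_zero_succAbove]
  simp

lemma bd_bd {K : Type} {n : ℕ} (c : TC K (n + 2)) : bd K n (bd K (n + 1) c) = 0 := by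
  suffices h : bd K n ∘ₗ bd K (n + 1) = 0 from LinearMap.congr_fun h c
  clear c
  induction n with
  | zero =>
    apply Finsupp.lhom_ext'
    intro v
    apply LinearMap.ext_ring
    obtain ⟨b, v, rfl⟩ : ∃ b w, v = (Fin.cons b w : Fin 2 → K) :=
      ⟨v 0, Fin.tail v, (Fin.cons_self_tail v).symm⟩
    simp only [LinearMap.comp_apply, Finsupp.lsingle_apply, LinearMap.zero_apply]
    rw [← cone_single, bd_cone, map_sub, bd_cone_zero, sub_self]
  | succ n ih =>
    apply Finsupp.lhom_ext'
    intro v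
    apply LinearMap.ext_ring
    obtain ⟨b, v, rfl⟩ : ∃ b w, v = (Fin.cons b w : Fin (n + 3) → K) :=
      ⟨v 0, Fin.tail v, (Fin.cons_self_tail v).symm⟩
    simp only [LinearMap.comp_apply, Finsupp.lsingle_apply, LinearMap.zero_apply]
    have := LinearMap.congr_fun ih (Finsupp.single v 1)
    simp only [LinearMap.comp_apply, LinearMap.zero_apply] at this
    rw [← cone_single, bd_cone, map_sub, bd_cone, this]
    simp

/-- Subdivision. -/
def sub {K : Type} (bary : ∀ n, (Fin (n + 1) → K) → K) : ∀ n, TC K n →ₗ[ℚ] TC K n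
  | 0 => LinearMap.id
  | n + 1 => Finsupp.linearCombination ℚ
      (fun v : Fin (n + 1) → K => cone (bary n v) n (sub bary n (bd K n (Finsupp.single v 1))))

/-- Homotopy between subdivision and the identity. -/
def subT {K : Type} (bary : ∀ n, (Fin (n + 1) → K) → K) : ∀ n, TC K n →ₗ[ℚ] TC K (n + 1)
  | 0 => 0
  | n + 1 => Finsupp.linearCombination ℚ
      (fun v : Fin (n + 1) → K => cone (bary n v) (n + 1)
        (Finsupp.single v 1 - subT bary n (bd K n (Finsupp.single v 1))))

section
variable {K : Type} (bary : ∀ n, (Fin (n + 1) → K) → K)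

lemma sub_single {n : ℕ} (v : Fin (n + 1) → K) : sub bary (n + 1) (Finsupp.single v 1) =
    cone (bary n v) n (sub bary n (bd K n (Finsupp.single v 1))) := by
  simp [sub]

lemma subT_single {n : ℕ} (v : Fin (n + 1) → K) : subT bary (n + 1) (Finsupp.single v 1) =
    cone (bary n v) (n + 1) (Finsupp.single v 1 - subT bary n (bd K n (Finsupp.single v 1))) := by
  simp [subT]

lemma bd_sub {n : ℕ} (c : TC K (n + 1)) :
    bd K n (sub bary (n + 1) c) = sub bary n (bd K n c) := by
  suffices h : bd K n ∘ₗ sub bary (n + 1) = sub bary n ∘ₗ bd K n from LinearMap.congr_fun h c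
  clear c
  induction n with
  | zero =>
    apply Finsupp.lhom_ext'
    intro v
    apply LinearMap.ext_ring
    simp only [LinearMap.comp_apply, Finsupp.lsingle_apply]
    rw [sub_single, bd_cone_zero]
  | succ n ih =>
    apply Finsupp.lhom_ext'
    intro v
    apply LinearMap.ext_ring
    simp only [LinearMap.comp_apply, Finsupp.lsingle_apply]
    have := LinearMap.congr_fun ih (bd K (n+1) (Finsupp.single v 1))
    simp only [LinearMap.comp_apply] at this
    rw [sub_single, bd_cone, this, bd_bd]
    simp

lemma bd_subT {n : ℕ} (c : TC K (n + 1)) :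
    bd K (n + 1) (subT bary (n + 1) c) + subT bary n (bd K n c) = c - sub bary (n + 1) c := by
  suffices h : bd K (n + 1) ∘ₗ subT bary (n + 1) + subT bary n ∘ₗ bd K n =
    LinearMap.id - sub bary (n + 1) from LinearMap.congr_fun h c
  clear c
  induction n with
  | zero =>
    apply Finsupp.lhom_ext'
    intro v
    apply LinearMap.ext_ring
    simp only [LinearMap.comp_apply, Finsupp.lsingle_apply, LinearMap.add_apply,
      LinearMap.sub_apply, LinearMap.id_apply]
    rw [sub_single, subT_single, bd_cone]
    simp [subT, sub]
  | succ n ih =>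
    apply Finsupp.lhom_ext'
    intro v
    apply LinearMap.ext_ring
    have := LinearMap.congr_fun ih (bd K (n+1) (Finsupp.single v 1))
    simp only [LinearMap.comp_apply, LinearMap.add_apply, bd_bd, map_zero, add_zero,
      LinearMap.sub_apply, LinearMap.id_apply] at this
    simp only [LinearMap.comp_apply, Finsupp.lsingle_apply, LinearMap.add_apply,
      LinearMap.sub_apply, LinearMap.id_apply]
    rw [sub_single, subT_single, bd_cone, map_sub, this]
    simp only [sub_sub_cancel]
    abel

end

/-- Functoriality of tuple chains. -/
def tmap {K K' : Type} (f : K → K') (n : ℕ) : TC K n →ₗ[ℚ] TC K' n :=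
  Finsupp.lmapDomain ℚ ℚ (fun v : Fin n → K => f ∘ v)

lemma tmap_single {K K' : Type} (f : K → K') {n : ℕ} (v : Fin n → K) (c : ℚ) :
    tmap f n (Finsupp.single v c) = Finsupp.single (f ∘ v) c := by
  simp [tmap]

lemma tmap_cone {K K' : Type} (f : K → K') {n : ℕ} (b : K) (c : TC K n) :
    tmap f (n + 1) (cone b n c) = cone (f b) n (tmap f n c) := by
  suffices h : tmap f (n + 1) ∘ₗ cone b n = cone (f b) n ∘ₗ tmap f n from LinearMap.congr_fun h c
  apply Finsupp.lhom_ext'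
  intro v
  apply LinearMap.ext_ring
  simp only [LinearMap.comp_apply, Finsupp.lsingle_apply]
  rw [cone_single, tmap_single, tmap_single, cone_single]
  congr 1
  funext j
  refine Fin.cases ?_ (fun j => ?_) j <;> simp

lemma tmap_bd {K K' : Type} (f : K → K') {n : ℕ} (c : TC K (n + 1)) :
    tmap f n (bd K n c) = bd K' n (tmap f (n + 1) c) := by
  suffices h : tmap f n ∘ₗ bd K n = bd K' n ∘ₗ tmap f (n + 1) from LinearMap.congr_fun h c
  apply Finsupp.lhom_ext'
  intro v
  apply LinearMap.ext_ring
  simp only [LinearMap.comp_apply, Finsupp.lsingle_apply]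
  rw [tmap_single, bd_single, bd_single, map_sum]
  refine Finset.sum_congr rfl fun i _ => ?_
  rw [map_smul, tmap_single]
  rfl

lemma tmap_sub {K K' : Type} (bary : ∀ n, (Fin (n + 1) → K) → K)
    (bary' : ∀ n, (Fin (n + 1) → K') → K') (f : K → K')
    (hf : ∀ n v, f (bary n v) = bary' n (f ∘ v)) {n : ℕ} (c : TC K n) :
    tmap f n (sub bary n c) = sub bary' n (tmap f n c) := by
  suffices h : tmap f n ∘ₗ sub bary n = sub bary' n ∘ₗ tmap f n from LinearMap.congr_fun h c
  clear c
  induction n with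
  | zero => rfl
  | succ n ih =>
    apply Finsupp.lhom_ext'
    intro v
    apply LinearMap.ext_ring
    have := LinearMap.congr_fun ih (bd K n (Finsupp.single v 1))
    simp only [LinearMap.comp_apply] at this
    simp only [LinearMap.comp_apply, Finsupp.lsingle_apply]
    rw [sub_single, tmap_cone, this, tmap_bd, tmap_single, sub_single, hf]

lemma tmap_subT {K K' : Type} (bary : ∀ n, (Fin (n + 1) → K) → K)
    (bary' : ∀ n, (Fin (n + 1) → K') → K') (f : K → K')
    (hf : ∀ n v, f (bary n v) = bary' n (f ∘ v)) {n : ℕ} (c : TC K n) :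
    tmap f (n + 1) (subT bary n c) = subT bary' n (tmap f n c) := by
  suffices h : tmap f (n + 1) ∘ₗ subT bary n = subT bary' n ∘ₗ tmap f n from
    LinearMap.congr_fun h c
  clear c
  induction n with
  | zero => simp [subT]
  | succ n ih =>
    apply Finsupp.lhom_ext'
    intro v
    apply LinearMap.ext_ring
    have := LinearMap.congr_fun ih (bd K n (Finsupp.single v 1))
    simp only [LinearMap.comp_apply] at this
    simp only [LinearMap.comp_apply, Finsupp.lsingle_apply]
    rw [subT_single, tmap_cone, map_sub, this, tmap_bd, tmap_single, subT_single, hf]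

/-! ### Supports of subdivided chains shrink -/

/-- The chains supported on tuples with property `P`. -/
def supp {α : Type} (P : α → Prop) : Submodule ℚ (α →₀ ℚ) := Finsupp.supported ℚ ℚ {v | P v}

lemma single_mem_supp {α : Type} {P : α → Prop} {v : α} (h : P v) (c : ℚ) :
    (Finsupp.single v c : α →₀ ℚ) ∈ supp P :=
  Finsupp.single_mem_supported ℚ c h

lemma map_mem_of_single {α : Type} {M : Type} [AddCommGroup M] [Module ℚ M] {P : α → Prop}
    (Q : Submodule ℚ M) (f : (α →₀ ℚ) →ₗ[ℚ] M)
    (h : ∀ v, P v → f (Finsupp.single v 1) ∈ Q) {c : α →₀ ℚ} (hc : c ∈ supp P) : f c ∈ Q := by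
  rw [supp, Finsupp.supported_eq_span_single] at hc
  have : Submodule.span ℚ ((fun i => (Finsupp.single i 1 : α →₀ ℚ)) '' {v | P v}) ≤ Q.comap f := by
    rw [Submodule.span_le]
    rintro _ ⟨v, hv, rfl⟩
    exact h v hv
  exact this hc

/-- Metric condition: mesh at most `D`, and the points lie in the metric hull of `h`. -/
def Mesh {K : Type} [MetricSpace K] (H : K → Prop) (D : ℝ) {n : ℕ} (v : Fin n → K) : Prop :=
  (∀ i, H (v i)) ∧ ∀ i j, dist (v i) (v j) ≤ D

/-- The metric hull of a tuple. -/
def MHull {K : Type} [MetricSpace K] {m : ℕ} (v : Fin m → K) (w : K) : Prop :=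
  ∀ p R, 0 ≤ R → (∀ j, dist p (v j) ≤ R) → dist p w ≤ R

lemma sub_mesh {K : Type} [MetricSpace K] (bary : ∀ n, (Fin (n + 1) → K) → K)
    (hb1 : ∀ n v, MHull v (bary n v))
    (hb2 : ∀ n v D, (∀ i j, dist (v i) (v j) ≤ D) →
      ∀ j, dist (bary n v) (v j) ≤ (n / (n + 1) : ℝ) * D) {n : ℕ}
    (v : Fin (n + 1) → K) (D : ℝ) (hD : 0 ≤ D) (hv : ∀ i j, dist (v i) (v j) ≤ D) :
    sub bary (n + 1) (Finsupp.single v 1) ∈ supp (Mesh (MHull v) ((n / (n + 1) : ℝ) * D)) := by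
  induction n with
  | zero =>
    rw [sub_single, bd_single]
    rw [Fin.sum_univ_one]
    rw [show sub bary 0 = LinearMap.id from rfl, LinearMap.id_apply, map_smul, cone_single]
    refine Submodule.smul_mem _ _ (single_mem_supp ⟨?_, ?_⟩ _)
    · intro i
      refine Fin.cases ?_ (fun j => j.elim0) i
      exact hb1 _ _
    · intro i j
      have : i = j := Subsingleton.elim (α := Fin 1) _ _
      subst this
      simp
  | succ n ih =>
    rw [sub_single, bd_single, map_sum, map_sum]
    refine Submodule.sum_mem _ fun i _ => ?_
    rw [map_smul, map_smul]
    refine Submodule.smul_mem _ _ ?_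
    refine map_mem_of_single _ _ ?_ (ih (v ∘ i.succAbove) (fun _ _ => hv _ _))
    intro w hw
    rw [cone_single]
    have hle : (n / (n + 1) : ℝ) * D ≤ ((n + 1 : ℕ) / ((n + 1 : ℕ) + 1) : ℝ) * D := by
      refine mul_le_mul_of_nonneg_right ?_ hD
      rw [div_le_div_iff₀ (by positivity) (by positivity)]
      push_cast
      nlinarith
    have hw1 : ∀ j, MHull v (w j) := fun j p R hR h => hw.1 j p R hR (fun k => h _)
    have hbw : ∀ j, dist (bary (n+1) v) (w j) ≤ ((n + 1 : ℕ) / ((n + 1 : ℕ) + 1) : ℝ) * D :=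
      fun j => hw1 j _ _ (by positivity) (hb2 _ v D hv)
    refine single_mem_supp ⟨?_, ?_⟩ _
    · intro j
      refine Fin.cases ?_ (fun j => ?_) j
      · exact hb1 _ _
      · simpa using hw1 j
    · intro j k
      refine Fin.cases ?_ (fun j => ?_) j
      · refine Fin.cases ?_ (fun k => ?_) k
        · simp; positivity
        · simpa using hbw k
      · refine Fin.cases ?_ (fun k => ?_) k
        · simpa [dist_comm] using hbw j
        · simpa using (hw.2 j k).trans hle

lemma sub_iter_mesh {K : Type} [MetricSpace K] (bary : ∀ n, (Fin (n + 1) → K) → K)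
    (hb1 : ∀ n v, MHull v (bary n v))
    (hb2 : ∀ n v D, (∀ i j, dist (v i) (v j) ≤ D) →
      ∀ j, dist (bary n v) (v j) ≤ (n / (n + 1) : ℝ) * D) {n : ℕ}
    (v : Fin (n + 1) → K) (D : ℝ) (hD : 0 ≤ D) (hv : ∀ i j, dist (v i) (v j) ≤ D) (k : ℕ) :
    (sub bary (n + 1))^[k] (Finsupp.single v 1) ∈
      supp (Mesh (fun _ => True) ((n / (n + 1) : ℝ) ^ k * D)) := by
  induction k with
  | zero =>
    simp only [Function.iterate_zero, id]
    exact single_mem_supp ⟨fun _ => trivial, fun i j => by simpa using hv i j⟩ _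
  | succ k ih =>
    rw [Function.iterate_succ_apply']
    refine map_mem_of_single _ _ ?_ ih
    intro w hw
    have := sub_mesh bary hb1 hb2 w _ (by positivity) hw.2
    refine Finsupp.supported_mono ?_ this
    intro u hu
    exact ⟨fun _ => trivial, fun i j => (hu.2 i j).trans (le_of_eq (by ring))⟩

/-! ### Mayer-Vietoris for simplicial sets -/

open Limits in
instance preservesAFMC : PreservesColimitsOfShape WalkingSpan
    (alternatingFaceMapComplex (ModuleCat.{0} ℚ)) := by
  refine HomologicalComplex.preservesColimitsOfShape_of_eval _ (fun n => ?_)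
  exact inferInstanceAs (PreservesColimitsOfShape WalkingSpan
    ((evaluation SimplexCategoryᵒᵖ (ModuleCat.{0} ℚ)).obj (Opposite.op (SimplexCategory.mk n))))

open Limits in
instance preservesFree : PreservesColimitsOfShape WalkingSpan
    ((SimplicialObject.whiskering (Type) (ModuleCat.{0} ℚ)).obj (ModuleCat.free ℚ)) := by
  have : PreservesColimitsOfShape WalkingSpan (ModuleCat.free.{0} ℚ) := 
    (ModuleCat.adj ℚ).leftAdjoint_preservesColimits.preservesColimitsOfShape
  exact inferInstanceAs (PreservesColimitsOfShape WalkingSpan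
    ((Functor.whiskeringRight SimplexCategoryᵒᵖ _ _).obj (ModuleCat.free.{0} ℚ)))

open Limits in
instance preservesFC : PreservesColimitsOfShape WalkingSpan FC := by
  unfold FC
  infer_instance

lemma FC_isPushout {X : SSet.{0}} (A B : X.Subcomplex) :
    IsPushout (FC.map (SSet.Subcomplex.homOfLE (inf_le_left : A ⊓ B ≤ A)))
      (FC.map (SSet.Subcomplex.homOfLE (inf_le_right : A ⊓ B ≤ B)))
      (FC.map (SSet.Subcomplex.homOfLE (le_sup_left : A ≤ A ⊔ B)))
      (FC.map (SSet.Subcomplex.homOfLE (le_sup_right : B ≤ A ⊔ B))) :=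
  (SSet.Subcomplex.BicartSq.isPushout (X := X) (A₁ := A ⊓ B) (A₂ := A) (A₃ := B)
    (A₄ := A ⊔ B) ⟨rfl, rfl⟩).map FC

instance FC_mono {X Y : SSet.{0}} (f : X ⟶ Y) [Mono f] : Mono (FC.map f) := by
  have : ∀ n, Mono ((FC.map f).f n) := by
    intro n
    rw [ModuleCat.mono_iff_injective]
    change Function.Injective (Finsupp.mapDomain _)
    apply Finsupp.mapDomain_injective
    exact (mono_iff_injective _).1 (NatTrans.mono_iff_mono_app f |>.1 inferInstance _)
  exact HomologicalComplex.mono_of_mono_f _ this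

lemma FC_shortExact {X : SSet.{0}} (A B : X.Subcomplex) :
    (FC_isPushout A B).toCommSq.shortComplex.ShortExact where
  exact := (FC_isPushout A B).exact_shortComplex
  epi_g := (FC_isPushout A B).epi_shortComplex_g
  mono_f := by
    have h : Mono ((FC_isPushout A B).toCommSq.shortComplex.f ≫ Limits.biprod.fst) := by
      simp only [CommSq.shortComplex, Limits.biprod.lift_fst]
      infer_instance
    exact mono_of_mono _ Limits.biprod.fst

lemma biprod_shortExact (K L : ChainComplex (ModuleCat.{0} ℚ) ℕ) :
    (ShortComplex.mk (Limits.biprod.inl : K ⟶ K ⊞ L) (Limits.biprod.snd : K ⊞ L ⟶ L)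
      (by simp)).ShortExact :=
  (ShortComplex.Splitting.ofHasBinaryBiproduct K L).shortExact

lemma HasChi.biprod {K L : ChainComplex (ModuleCat.{0} ℚ) ℕ} {a b : ℤ} (ha : HasChi K a)
    (hb : HasChi L b) : HasChi (K ⊞ L) (a + b) :=
  HasChi.mid _ (biprod_shortExact K L) ha hb

lemma FC_mv1 {X : SSet.{0}} (A B : X.Subcomplex) {a b c : ℤ}
    (ha : HasChi (FC.obj (A : SSet)) a) (hb : HasChi (FC.obj (B : SSet)) b) 
    (hc : HasChi (FC.obj ((A ⊓ B : X.Subcomplex) : SSet)) c) :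
    HasChi (FC.obj ((A ⊔ B : X.Subcomplex) : SSet)) (a + b - c) :=
  HasChi.right _ (FC_shortExact A B) hc (ha.biprod hb)

lemma FC_mv2 {X : SSet.{0}} (A B : X.Subcomplex) {b c x : ℤ}
    (hx : HasChi (FC.obj ((A ⊔ B : X.Subcomplex) : SSet)) x)
    (hb : HasChi (FC.obj (B : SSet)) b) 
    (hc : HasChi (FC.obj ((A ⊓ B : X.Subcomplex) : SSet)) c) :
    HasChi (FC.obj (A : SSet)) (x + c - b) := by
  have h1 := HasChi.mid _ (FC_shortExact A B) hc hx
  have h2 := HasChi.left _ (biprod_shortExact (FC.obj (A : SSet)) (FC.obj (B : SSet))) h1 hb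
  rwa [add_comm c x] at h2

/-! ### Affine simplices and subdivision of singular chains -/

/-- The standard simplex. -/
abbrev Sx (m : ℕ) := stdSimplex ℝ (Fin (m + 1))

/-- Convex combination of points of a simplex. -/
def cmb {m n : ℕ} (v : Fin (n + 1) → Sx m) (t : Sx n) : Sx m :=
  ⟨fun j => ∑ i, t i * v i j, fun j => Finset.sum_nonneg fun i _ => mul_nonneg (t.2.1 i) ((v i).2.1 j), by
    rw [Finset.sum_comm]
    simp_rw [← Finset.mul_sum, stdSimplex.sum_eq_one, mul_one]
    exact stdSimplex.sum_eq_one t⟩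

lemma cmb_apply {m n : ℕ} (v : Fin (n + 1) → Sx m) (t : Sx n) (j) :
    cmb v t j = ∑ i, t i * v i j := rfl

lemma sx_ext {m : ℕ} {s t : Sx m} (h : ∀ j, s j = t j) : s = t :=
  stdSimplex.ext (funext h)

lemma cmb_cmb {m n k : ℕ} (u : Fin (n + 1) → Sx m) (v : Fin (k + 1) → Sx n) (t : Sx k) :
    cmb u (cmb v t) = cmb (fun i => cmb u (v i)) t := by
  apply sx_ext; intro j
  simp only [cmb_apply, Finset.sum_mul, Finset.mul_sum]
  rw [Finset.sum_comm]
  simp only [mul_assoc]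

/-- The tuple of vertices. -/
def vtx (m : ℕ) : Fin (m + 1) → Sx m := fun i => stdSimplex.vertex i

lemma vtx_apply (m : ℕ) (i j : Fin (m + 1)) : vtx m i j = if j = i then 1 else 0 := by
  simp [vtx, stdSimplex.vertex, Pi.single_apply, DFunLike.coe]

lemma cmb_vtx {m n : ℕ} (u : Fin (n + 1) → Sx m) (i) : cmb u (vtx n i) = u i := by
  apply sx_ext; intro j
  simp [cmb_apply, vtx_apply]

lemma cmb_vtx_left {m : ℕ} (t : Sx m) : cmb (vtx m) t = t := by
  apply sx_ext; intro j
  simp [cmb_apply, vtx_apply]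

lemma map_eq_cmb {m n : ℕ} (f : Fin (m + 1) → Fin (n + 1)) (t : Sx m) :
    stdSimplex.map f t = cmb (fun i => vtx n (f i)) t := by
  apply sx_ext; intro j
  simp only [cmb_apply, vtx_apply]
  change (FunOnFinite.linearMap ℝ ℝ f t) j = _
  rw [FunOnFinite.linearMap_apply_apply]
  simp [Finset.sum_filter, eq_comm]

lemma continuous_cmb {m n : ℕ} (v : Fin (n + 1) → Sx m) : Continuous (cmb v) := by
  refine Continuous.subtype_mk ?_ _
  refine continuous_pi fun j => continuous_finsetSum _ fun i _ => ?_
  refine Continuous.mul ?_ continuous_const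
  exact (continuous_apply i).comp continuous_subtype_val

/-- Affine simplices as continuous maps. -/
def cmbC {m n : ℕ} (v : Fin (n + 1) → Sx m) : C(Sx n, Sx m) := ⟨cmb v, continuous_cmb v⟩

/-- The barycenter of a tuple. -/
def bry (m : ℕ) (n : ℕ) (v : Fin (n + 1) → Sx m) : Sx m := cmb v stdSimplex.barycenter

lemma bry_nat {m k : ℕ} (u : Fin (k + 1) → Sx m) (n : ℕ) (v : Fin (n + 1) → Sx k) :
    cmb u (bry k n v) = bry m n (cmb u ∘ v) := by
  rw [bry, cmb_cmb]; rfl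

lemma dist_cmb_le {m n : ℕ} (v : Fin (n + 1) → Sx m) (t : Sx n) (p : Sx m) (r : Fin (n + 1) → ℝ)
    (h : ∀ i, dist p (v i) ≤ r i) : dist p (cmb v t) ≤ ∑ i, t i * r i := by
  have hr : ∀ i, 0 ≤ r i := fun i => dist_nonneg.trans (h i)
  refine (dist_pi_le_iff (Finset.sum_nonneg fun i _ => mul_nonneg (t.2.1 i) (hr i))).2 ?_
  intro j
  have h1 : (p : Fin (m + 1) → ℝ) j - (cmb v t : Fin (m + 1) → ℝ) j = ∑ i, t i * (p j - v i j) := by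
    simp only [mul_sub, Finset.sum_sub_distrib, ← Finset.sum_mul, stdSimplex.sum_eq_one, one_mul]
    rfl
  rw [Real.dist_eq]
  change |p j - (cmb v t) j| ≤ ∑ i, t i * r i
  rw [h1]
  refine (Finset.abs_sum_le_sum_abs _ _).trans (Finset.sum_le_sum fun i _ => ?_)
  rw [abs_mul, abs_of_nonneg (stdSimplex.zero_le t i)]
  refine mul_le_mul_of_nonneg_left ?_ (stdSimplex.zero_le t i)
  have := (dist_le_pi_dist (p : Fin (m + 1) → ℝ) (v i) j).trans (h i)
  rwa [Real.dist_eq] at this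

lemma bry_hull {m : ℕ} (n : ℕ) (v : Fin (n + 1) → Sx m) : MHull v (bry m n v) := by
  intro p R _ h
  refine (dist_cmb_le v _ p (fun _ => R) h).trans ?_
  rw [← Finset.sum_mul, stdSimplex.sum_eq_one, one_mul]

lemma bry_dist {m : ℕ} (n : ℕ) (v : Fin (n + 1) → Sx m) (D : ℝ) (h : ∀ i j, dist (v i) (v j) ≤ D)
    (j) : dist (bry m n v) (v j) ≤ (n / (n + 1) : ℝ) * D := by
  rw [dist_comm]
  refine (dist_cmb_le v _ (v j) (fun i => if i = j then 0 else D) ?_).trans ?_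
  · intro i
    split_ifs with hi
    · simp [hi]
    · exact h _ _
  · have h0 : ∀ i : Fin (n + 1), (stdSimplex.barycenter : Sx n) i = ((n : ℝ) + 1)⁻¹ := fun i => by
      refine (stdSimplex.barycenter_apply (𝕜 := ℝ) i).trans ?_
      simp
    simp only [h0, ← Finset.mul_sum]
    have h1 : (∑ i : Fin (n + 1), if i = j then (0 : ℝ) else D) = n * D := by
      have : ∀ i : Fin (n + 1), (if i = j then (0 : ℝ) else D) = D - if i = j then D else 0 := by
        intro i; split_ifs <;> simp
      simp only [this, Finset.sum_sub_distrib]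
      simp
      ring
    rw [h1]
    apply le_of_eq
    field_simp

section
variable {X : Type} [TopologicalSpace X]

/-- Singular chains. -/
abbrev CS (X : Type) [TopologicalSpace X] (n : ℕ) := C(Sx n, X) →₀ ℚ

/-- The face inclusion. -/
def fc (n : ℕ) (i : Fin (n + 2)) : C(Sx n, Sx (n + 1)) := cmbC (fun j => vtx (n + 1) (i.succAbove j))

/-- Singular boundary. -/
def dX (X : Type) [TopologicalSpace X] (n : ℕ) : CS X (n + 1) →ₗ[ℚ] CS X n :=
  Finsupp.linearCombination ℚ (fun σ : C(Sx (n + 1), X) => ∑ i : Fin (n + 2),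
      (-1 : ℚ) ^ (i : ℕ) • (Finsupp.single (σ.comp (fc n i)) (1 : ℚ) : CS X n))

lemma dX_single {n : ℕ} (σ : C(Sx (n + 1), X)) : dX X n (Finsupp.single σ 1) =
    ∑ i : Fin (n + 2),
      (-1 : ℚ) ^ (i : ℕ) • (Finsupp.single (σ.comp (fc n i)) (1 : ℚ) : CS X n) := by
  simp [dX]

/-- Realization of an affine chain along a singular simplex. -/
def rlz {m : ℕ} (σ : C(Sx m, X)) (n : ℕ) : TC (Sx m) (n + 1) →ₗ[ℚ] CS X n :=
  Finsupp.lmapDomain ℚ ℚ (fun v => σ.comp (cmbC v))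

lemma rlz_single {m : ℕ} (σ : C(Sx m, X)) {n : ℕ} (v : Fin (n + 1) → Sx m) (c : ℚ) :
    rlz σ n (Finsupp.single v c) = Finsupp.single (σ.comp (cmbC v)) c := by
  simp [rlz]

lemma rlz_vtx {m : ℕ} (σ : C(Sx m, X)) (c : ℚ) :
    rlz σ m (Finsupp.single (vtx m) c) = Finsupp.single σ c := by
  rw [rlz_single]
  congr 1
  ext t
  simp [cmbC, cmb_vtx_left]

lemma dX_rlz {m : ℕ} (σ : C(Sx m, X)) {n : ℕ} (c : TC (Sx m) (n + 2)) :
    dX X n (rlz σ (n + 1) c) = rlz σ n (bd _ (n + 1) c) := by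
  suffices h : dX X n ∘ₗ rlz σ (n + 1) = rlz σ n ∘ₗ bd _ (n + 1) from LinearMap.congr_fun h c
  apply Finsupp.lhom_ext'
  intro v
  apply LinearMap.ext_ring
  simp only [LinearMap.comp_apply, Finsupp.lsingle_apply]
  rw [rlz_single, dX_single, bd_single, map_sum]
  refine Finset.sum_congr rfl fun i _ => ?_
  rw [map_smul, rlz_single]
  congr 2
  ext t
  simp only [ContinuousMap.comp_apply, fc, cmbC, ContinuousMap.coe_mk, cmb_cmb, cmb_vtx]
  rfl

lemma rlz_comp {m k : ℕ} (σ : C(Sx m, X)) (u : Fin (k + 1) → Sx m) {n : ℕ} (c : TC (Sx k) (n + 1)) :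
    rlz (σ.comp (cmbC u)) n c = rlz σ n (tmap (cmb u) (n + 1) c) := by
  suffices h : rlz (σ.comp (cmbC u)) n = rlz σ n ∘ₗ tmap (cmb u) (n + 1) from LinearMap.congr_fun h c
  apply Finsupp.lhom_ext'
  intro v
  apply LinearMap.ext_ring
  simp only [LinearMap.comp_apply, Finsupp.lsingle_apply]
  rw [rlz_single, tmap_single, rlz_single]
  congr 1
  ext t
  simp only [ContinuousMap.comp_apply, cmbC, ContinuousMap.coe_mk, cmb_cmb]
  rfl

/-- Subdivision of singular chains. -/
def SX (X : Type) [TopologicalSpace X] (n : ℕ) : CS X n →ₗ[ℚ] CS X n :=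
  Finsupp.linearCombination ℚ (fun σ => rlz σ n (sub (bry n) (n + 1) (Finsupp.single (vtx n) 1)))

/-- Subdivision homotopy. -/
def TX (X : Type) [TopologicalSpace X] (n : ℕ) : CS X n →ₗ[ℚ] CS X (n + 1) :=
  Finsupp.linearCombination ℚ
    (fun σ => rlz σ (n + 1) (subT (bry n) (n + 1) (Finsupp.single (vtx n) 1)))

lemma cmb_comp_vtx {m n : ℕ} (v : Fin (n + 1) → Sx m) : cmb v ∘ vtx n = v :=
  funext fun i => cmb_vtx v i

lemma SX_rlz {m : ℕ} (σ : C(Sx m, X)) {n : ℕ} (c : TC (Sx m) (n + 1)) :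
    SX X n (rlz σ n c) = rlz σ n (sub (bry m) (n + 1) c) := by
  suffices h : SX X n ∘ₗ rlz σ n = rlz σ n ∘ₗ sub (bry m) (n + 1) from LinearMap.congr_fun h c
  apply Finsupp.lhom_ext'
  intro v
  apply LinearMap.ext_ring
  simp only [LinearMap.comp_apply, Finsupp.lsingle_apply]
  rw [rlz_single, SX, Finsupp.linearCombination_single, one_smul, rlz_comp,
    tmap_sub _ (bry m) _ (bry_nat v), tmap_single, cmb_comp_vtx]

lemma TX_rlz {m : ℕ} (σ : C(Sx m, X)) {n : ℕ} (c : TC (Sx m) (n + 1)) :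
    TX X n (rlz σ n c) = rlz σ (n + 1) (subT (bry m) (n + 1) c) := by
  suffices h : TX X n ∘ₗ rlz σ n = rlz σ (n + 1) ∘ₗ subT (bry m) (n + 1) from LinearMap.congr_fun h c
  apply Finsupp.lhom_ext'
  intro v
  apply LinearMap.ext_ring
  simp only [LinearMap.comp_apply, Finsupp.lsingle_apply]
  rw [rlz_single, TX, Finsupp.linearCombination_single, one_smul, rlz_comp,
    tmap_subT _ (bry m) _ (bry_nat v), tmap_single, cmb_comp_vtx]

lemma dX_SX {n : ℕ} (c : CS X (n + 1)) : dX X n (SX X (n + 1) c) = SX X n (dX X n c) := by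
  suffices h : dX X n ∘ₗ SX X (n + 1) = SX X n ∘ₗ dX X n from LinearMap.congr_fun h c
  apply Finsupp.lhom_ext'
  intro σ
  apply LinearMap.ext_ring
  simp only [LinearMap.comp_apply, Finsupp.lsingle_apply]
  rw [← rlz_vtx, SX_rlz, dX_rlz, dX_rlz, SX_rlz, bd_sub]

lemma dX_TX {n : ℕ} (c : CS X (n + 1)) :
    dX X (n + 1) (TX X (n + 1) c) + TX X n (dX X n c) = c - SX X (n + 1) c := by
  suffices h : dX X (n + 1) ∘ₗ TX X (n + 1) + TX X n ∘ₗ dX X n = LinearMap.id - SX X (n + 1) from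
    LinearMap.congr_fun h c
  apply Finsupp.lhom_ext'
  intro σ
  apply LinearMap.ext_ring
  simp only [LinearMap.comp_apply, Finsupp.lsingle_apply, LinearMap.add_apply, LinearMap.sub_apply,
    LinearMap.id_apply]
  rw [← rlz_vtx, TX_rlz, dX_rlz, dX_rlz, TX_rlz, SX_rlz, ← map_add, ← map_sub, bd_subT]

lemma dX_TX_zero (c : CS X 0) : dX X 0 (TX X 0 c) = c - SX X 0 c := by
  suffices h : dX X 0 ∘ₗ TX X 0 = LinearMap.id - SX X 0 from
    LinearMap.congr_fun h c
  apply Finsupp.lhom_ext'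
  intro σ
  apply LinearMap.ext_ring
  simp only [LinearMap.comp_apply, Finsupp.lsingle_apply, LinearMap.sub_apply,
    LinearMap.id_apply]
  rw [← rlz_vtx, TX_rlz, dX_rlz, SX_rlz, ← map_sub, ← bd_subT]
  simp [subT]

/-- Smallness of a singular simplex. -/
def Sml (U V : Set X) (n : ℕ) (σ : C(Sx n, X)) : Prop := (∀ t, σ t ∈ U) ∨ (∀ t, σ t ∈ V)

lemma rlz_sml (U V : Set X) {m : ℕ} (σ : C(Sx m, X)) (h : Sml U V m σ) {n : ℕ}
    (c : TC (Sx m) (n + 1)) : rlz σ n c ∈ supp (Sml U V n) := by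
  refine map_mem_of_single (P := fun _ => True) _ _ ?_ ?_
  · intro v _
    rw [rlz_single]
    refine single_mem_supp ?_ _
    exact h.imp (fun h t => h _) (fun h t => h _)
  · simp [supp]

lemma SX_sml (U V : Set X) {n : ℕ} {c : CS X n} (hc : c ∈ supp (Sml U V n)) :
    SX X n c ∈ supp (Sml U V n) := by
  refine map_mem_of_single _ _ ?_ hc
  intro σ hσ
  rw [← rlz_vtx, SX_rlz]
  exact rlz_sml U V σ hσ _

lemma TX_sml (U V : Set X) {n : ℕ} {c : CS X n} (hc : c ∈ supp (Sml U V n)) :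
    TX X n c ∈ supp (Sml U V (n + 1)) := by
  refine map_mem_of_single _ _ ?_ hc
  intro σ hσ
  rw [← rlz_vtx, TX_rlz]
  exact rlz_sml U V σ hσ _

lemma SX_iter_rlz {m : ℕ} (σ : C(Sx m, X)) {n : ℕ} (c : TC (Sx m) (n + 1)) (k : ℕ) :
    (SX X n)^[k] (rlz σ n c) = rlz σ n ((sub (bry m) (n + 1))^[k] c) := by
  induction k with
  | zero => rfl
  | succ k ih => rw [Function.iterate_succ_apply', Function.iterate_succ_apply', ih, SX_rlz]

lemma exists_sml_single {U V : Set X} (hU : IsOpen U) (hV : IsOpen V) (hUV : ∀ x, x ∈ U ∨ x ∈ V)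
    {n : ℕ} (σ : C(Sx n, X)) : ∃ k, (SX X n)^[k] (Finsupp.single σ 1) ∈ supp (Sml U V n) := by
  obtain ⟨δ, hδ, h⟩ := lebesgue_number_lemma_of_metric (s := (Set.univ : Set (Sx n)))
    (c := fun b : Bool => if b then σ ⁻¹' U else σ ⁻¹' V) isCompact_univ
    (by rintro (_ | _)
        · exact hV.preimage σ.continuous
        · exact hU.preimage σ.continuous)
    (by intro t _
        rcases hUV (σ t) with h | h
        · exact Set.mem_iUnion.2 ⟨true, h⟩
        · exact Set.mem_iUnion.2 ⟨false, h⟩)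
  have hq : (n / (n + 1) : ℝ) < 1 := by rw [div_lt_one (by positivity)]; linarith
  set D := Metric.diam (Set.univ : Set (Sx n)) with hDdef
  have hD : 0 ≤ D := Metric.diam_nonneg
  obtain ⟨k, hk⟩ : ∃ k : ℕ, (n / (n + 1) : ℝ) ^ k * (D + 1) < δ := by
    obtain ⟨k, hk⟩ := exists_pow_lt_of_lt_one (show 0 < δ / (D + 1) by positivity) hq
    exact ⟨k, by rwa [lt_div_iff₀ (by positivity)] at hk⟩
  refine ⟨k, ?_⟩
  rw [← rlz_vtx, SX_iter_rlz]
  refine map_mem_of_single _ _ ?_ (sub_iter_mesh (bry n) bry_hull bry_dist (vtx n) (D + 1)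
    (by positivity) ?_ k)
  · intro v hv
    rw [rlz_single]
    refine single_mem_supp ?_ _
    obtain ⟨b, hb⟩ := h (v 0) trivial
    have : ∀ t, cmb v t ∈ Metric.ball (v 0) δ := by
      intro t
      rw [Metric.mem_ball, dist_comm]
      refine lt_of_le_of_lt (dist_cmb_le v t (v 0) _ (fun i => hv.2 0 i)) ?_
      rwa [← Finset.sum_mul, stdSimplex.sum_eq_one, one_mul]
    cases b
    · exact Or.inr fun t => hb (this t)
    · exact Or.inl fun t => hb (this t)
  · intro i j
    have := Metric.dist_le_diam_of_mem (s := (Set.univ : Set (Sx n))) isCompact_univ.isBounded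
      (Set.mem_univ (vtx n i)) (Set.mem_univ (vtx n j))
    linarith

lemma SX_iter_sml (U V : Set X) {n : ℕ} {c : CS X n} (hc : c ∈ supp (Sml U V n)) (k : ℕ) :
    (SX X n)^[k] c ∈ supp (Sml U V n) := by
  induction k with
  | zero => exact hc
  | succ k ih => rw [Function.iterate_succ_apply']; exact SX_sml U V ih

lemma exists_sml {U V : Set X} (hU : IsOpen U) (hV : IsOpen V) (hUV : ∀ x, x ∈ U ∨ x ∈ V)
    {n : ℕ} (c : CS X n) : ∃ k, (SX X n)^[k] c ∈ supp (Sml U V n) := by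
  induction c using Finsupp.induction_linear with
  | zero => exact ⟨0, Submodule.zero_mem _⟩
  | add f g hf hg =>
    obtain ⟨k, hk⟩ := hf
    obtain ⟨l, hl⟩ := hg
    refine ⟨k + l, ?_⟩
    rw [← Module.End.pow_apply, map_add, Module.End.pow_apply, Module.End.pow_apply]
    refine Submodule.add_mem _ ?_ ?_
    · rw [add_comm k l, Function.iterate_add_apply]
      exact SX_iter_sml U V hk l
    · rw [Function.iterate_add_apply]
      exact SX_iter_sml U V hl k
  | single σ a =>
    obtain ⟨k, hk⟩ := exists_sml_single hU hV hUV σ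
    refine ⟨k, ?_⟩
    rw [← mul_one a, ← smul_eq_mul, ← Finsupp.smul_single, ← Module.End.pow_apply, map_smul, Module.End.pow_apply]
    exact Submodule.smul_mem _ _ hk

lemma small_succ {U V : Set X} (hU : IsOpen U) (hV : IsOpen V) (hUV : ∀ x, x ∈ U ∨ x ∈ V)
    {n : ℕ} (c : CS X (n + 1)) (hc : dX X n c ∈ supp (Sml U V n)) :
    ∃ e, c - dX X (n + 1) e ∈ supp (Sml U V (n + 1)) := by
  obtain ⟨k, hk⟩ := exists_sml hU hV hUV c
  induction k generalizing c with
  | zero => exact ⟨0, by simpa using hk⟩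
  | succ k ih =>
    rw [Function.iterate_succ_apply] at hk
    obtain ⟨e, he⟩ := ih (SX X (n + 1) c) (by rw [dX_SX]; exact SX_sml U V hc) hk
    refine ⟨e + TX X (n + 1) c, ?_⟩
    have h := dX_TX c
    have h2 := Submodule.add_mem _ he (TX_sml U V hc)
    convert h2 using 1
    rw [map_add, eq_sub_of_add_eq h]
    abel

lemma small_zero {U V : Set X} (hUV : ∀ x, x ∈ U ∨ x ∈ V)
    (c : CS X 0) : c ∈ supp (Sml U V 0) := by
  refine Finsupp.mem_supported _ _ |>.2 fun σ _ => ?_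
  rcases hUV (σ default) with h | h
  · exact Or.inl fun t => by rwa [Subsingleton.elim t default]
  · exact Or.inr fun t => by rwa [Subsingleton.elim t default]

end

/-! ### Mayer-Vietoris for singular homology -/

lemma HasChi.of_iso {K L : ChainComplex (ModuleCat.{0} ℚ) ℕ} (e : K ≅ L) {x : ℤ}
    (h : HasChi K x) : HasChi L x :=
  h.of_homology_iso fun n => (HomologicalComplex.homologyFunctor _ _ n).mapIso e

lemma HasChi.zero_of_exact {K : ChainComplex (ModuleCat.{0} ℚ) ℕ} (h : ∀ n, K.ExactAt n) :
    HasChi K 0 := by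
  have h0 : ∀ n, Subsingleton (K.homology n) := fun n =>
    ModuleCat.subsingleton_of_isZero ((h n).isZero_homology)
  have h1 : ∀ n, Module.finrank ℚ (K.homology n) = 0 := fun n => by
    have := h0 n
    exact Module.finrank_zero_of_subsingleton
  refine ⟨fun n => ?_, 0, fun M _ => ⟨h1 M, by simp [h1]⟩⟩
  have := h0 n
  infer_instance

lemma quot_acyclic (S : ShortComplex (ChainComplex (ModuleCat.{0} ℚ) ℕ)) (hS : S.ShortExact)
    (h0 : ∀ c : S.X₂.X 0, ∃ a : S.X₁.X 0, (S.f.f 0).hom a = c)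
    (h1 : ∀ n (c : S.X₂.X (n + 1)) (b : S.X₁.X n), (S.f.f n).hom b = (S.X₂.d (n + 1) n).hom c →
      ∃ (e : S.X₂.X (n + 2)) (a : S.X₁.X (n + 1)),
        c = (S.X₂.d (n + 2) (n + 1)).hom e + (S.f.f (n + 1)).hom a) :
    HasChi S.X₃ 0 := by
  have hS' : ∀ n, (S.map (HomologicalComplex.eval _ _ n)).ShortExact := fun n =>
    hS.map_of_exact _
  have hsurj : ∀ n, Function.Surjective (S.g.f n).hom := fun n =>
    (ModuleCat.epi_iff_surjective _).1 (hS' n).epi_g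
  have hex : ∀ n (x : S.X₂.X n), (S.g.f n).hom x = 0 → ∃ y, (S.f.f n).hom y = x := fun n =>
    (ShortComplex.moduleCat_exact_iff _).1 (hS' n).exact
  have hgf : ∀ n (y : S.X₁.X n), (S.g.f n).hom ((S.f.f n).hom y) = 0 := fun n y => by
    have := (S.map (HomologicalComplex.eval _ _ n)).moduleCat_zero_apply y
    exact this
  have hcomm : ∀ i j (x : S.X₂.X i), (S.g.f j).hom ((S.X₂.d i j).hom x) =
      (S.X₃.d i j).hom ((S.g.f i).hom x) := fun i j x => by
    have := congrArg (fun f => f.hom x) (S.g.comm i j)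
    exact this.symm
  apply HasChi.zero_of_exact
  intro n
  cases n with
  | zero =>
    rw [HomologicalComplex.exactAt_iff' _ 1 0 0 (by simp) (by simp), ShortComplex.moduleCat_exact_iff]
    intro x _
    refine ⟨0, ?_⟩
    obtain ⟨c, rfl⟩ := hsurj 0 x
    obtain ⟨a, rfl⟩ := h0 c
    rw [map_zero]
    exact (hgf 0 a).symm
  | succ n =>
    rw [HomologicalComplex.exactAt_iff' _ (n+2) (n+1) n (by simp) (by simp),
      ShortComplex.moduleCat_exact_iff]
    intro x hx
    obtain ⟨c, rfl⟩ := hsurj (n+1) x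
    have hx' : (S.X₃.d (n+1) n).hom ((S.g.f (n+1)).hom c) = 0 := hx
    rw [← hcomm] at hx'
    obtain ⟨b, hb⟩ := hex _ _ hx'
    obtain ⟨e, a, hc⟩ := h1 n c b hb
    refine ⟨(S.g.f (n+2)).hom e, ?_⟩
    change (S.X₃.d (n+2) (n+1)).hom ((S.g.f (n+2)).hom e) = (S.g.f (n+1)).hom c
    rw [← hcomm, hc, map_add, hgf, add_zero]

/-- The subcomplex of simplices in `U`. -/
def AU {X : Type} [TopologicalSpace X] (U : Set X) :
    (TopCat.toSSet.obj (TopCat.of X)).Subcomplex :=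
  SSet.Subcomplex.range (TopCat.toSSet.map (TopCat.ofHom (X := U) (Y := X)
    ⟨Subtype.val, continuous_subtype_val⟩))

lemma mem_AU {X : Type} [TopologicalSpace X] (U : Set X) {n : SimplexCategoryᵒᵖ}
    (s : (TopCat.toSSet.obj (TopCat.of X)).obj n) :
    s ∈ (AU U).obj n ↔ ∀ t, TopCat.toSSetObjEquiv _ _ s t ∈ U := by
  constructor
  · rintro ⟨s, rfl⟩ t
    exact (TopCat.toSSetObjEquiv _ _ s t).2
  · intro h
    refine ⟨(TopCat.toSSetObjEquiv (TopCat.of U) _).symm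
      ⟨fun t => ⟨TopCat.toSSetObjEquiv _ _ s t, h t⟩, ?_⟩, ?_⟩
    · exact Continuous.subtype_mk (ContinuousMap.continuous _) _
    · apply (TopCat.toSSetObjEquiv _ _).injective
      rfl

lemma AU_inf {X : Type} [TopologicalSpace X] (U V : Set X) : AU U ⊓ AU V = AU (U ∩ V) := by
  ext n s
  change (s ∈ (AU U).obj n ∧ s ∈ (AU V).obj n) ↔ _
  rw [mem_AU, mem_AU, mem_AU]
  exact ⟨fun h t => ⟨h.1 t, h.2 t⟩, fun h => ⟨fun t => (h t).1, fun t => (h t).2⟩⟩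

instance mono_incl {X : Type} [TopologicalSpace X] (U : Set X) :
    Mono (TopCat.toSSet.map (TopCat.ofHom (X := U) (Y := X)
      ⟨Subtype.val, continuous_subtype_val⟩)) := by
  have : Mono (TopCat.ofHom (X := U) (Y := X) ⟨Subtype.val, continuous_subtype_val⟩) :=
    (TopCat.mono_iff_injective _).2 Subtype.val_injective
  infer_instance

instance isIso_toRange {Y Z : SSet.{0}} (f : Y ⟶ Z) [Mono f] :
    IsIso (SSet.Subcomplex.toRange f) := by
  have h1 : Mono (SSet.Subcomplex.toRange f) := by
    have : Mono (SSet.Subcomplex.toRange f ≫ (SSet.Subcomplex.range f).ι) := by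
      rw [SSet.Subcomplex.toRange_ι]; infer_instance
    exact mono_of_mono _ (SSet.Subcomplex.range f).ι
  have h2 : Epi (SSet.Subcomplex.toRange f) := by
    rw [NatTrans.epi_iff_epi_app]
    intro n
    rw [CategoryTheory.epi_iff_surjective]
    rintro ⟨_, y, rfl⟩
    exact ⟨y, rfl⟩
  exact isIso_of_mono_of_epi _

/-- Simplices in `U` form the singular set of `U`. -/
def AUiso {X : Type} [TopologicalSpace X] (U : Set X) :
    TopCat.toSSet.obj (TopCat.of U) ≅ ((AU U) : SSet) :=
  @asIso _ _ _ _ _ (@isIso_toRange _ _ _ (mono_incl U))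

lemma hasChi_AU {X : Type} [TopologicalSpace X] (U : Set X) {a : ℤ} :
    HasChi (FC.obj ((AU U : (TopCat.toSSet.obj (TopCat.of X)).Subcomplex) : SSet)) a ↔ HC U a :=
  ⟨fun h => h.of_iso (FC.mapIso (AUiso U).symm), fun h => HasChi.of_iso (FC.mapIso (AUiso U)) h⟩

open Simplicial in
lemma FC_d_single (Y : SSet.{0}) (n : ℕ) (y : Y _⦋n + 1⦌) :
    ((FC.obj Y).d (n + 1) n).hom (Finsupp.single y (1 : ℚ) : Y _⦋n + 1⦌ →₀ ℚ) =
      (∑ i : Fin (n + 2), (-1 : ℚ) ^ (i : ℕ) • Finsupp.single (Y.δ i y) (1 : ℚ) : Y _⦋n⦌ →₀ ℚ) := by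
  have : (FC.obj Y).d (n + 1) n = AlternatingFaceMapComplex.objD
    (((SimplicialObject.whiskering _ _).obj (ModuleCat.free ℚ)).obj Y) n :=
    alternatingFaceMapComplex_obj_d _ _
  rw [this, AlternatingFaceMapComplex.objD, ModuleCat.hom_sum]
  refine (LinearMap.sum_apply _ _ _).trans ?_
  refine Finset.sum_congr rfl fun i _ => ?_
  rw [ModuleCat.hom_zsmul]
  have h2 : (ModuleCat.Hom.hom ((((SimplicialObject.whiskering _ _).obj (ModuleCat.free ℚ)).obj Y).δ i))
     (Finsupp.single y (1 : ℚ) : Y _⦋n + 1⦌ →₀ ℚ) = (Finsupp.single (Y.δ i y) (1 : ℚ) : Y _⦋n⦌ →₀ ℚ) :=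
    Finsupp.mapDomain_single
  refine (LinearMap.smul_apply _ _ _).trans ?_
  refine (congrArg (fun z => ((-1 : ℤ) ^ (i : ℕ)) • z) h2).trans ?_
  rcases Nat.even_or_odd (i : ℕ) with h | h
  · simp only [h.neg_one_pow]
    exact (one_zsmul _).trans (one_smul ℚ _).symm
  · simp only [h.neg_one_pow]
    exact (neg_one_zsmul _).trans (neg_one_smul ℚ _).symm

lemma domL_apply {α β : Type} (e : α ≃ β) (c : α →₀ ℚ) (x : α) :
    ((Finsupp.domLCongr e : (α →₀ ℚ) ≃ₗ[ℚ] (β →₀ ℚ)) c) (e x) = c x := by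
  simp [Finsupp.domLCongr_apply, Finsupp.domCongr, Finsupp.equivMapDomain_apply]

open Simplicial in
/-- Comparison of the two descriptions of singular chains. -/
def phi (X : Type) [TopologicalSpace X] (n : ℕ) :
    ((TopCat.toSSet.obj (TopCat.of X)) _⦋n⦌ →₀ ℚ) ≃ₗ[ℚ] CS X n :=
  Finsupp.domLCongr (TopCat.toSSetObjEquiv (TopCat.of X) _)

lemma phi_d (X : Type) [TopologicalSpace X] (n : ℕ)
    (c : (FC.obj (TopCat.toSSet.obj (TopCat.of X))).X (n + 1)) :
    phi X n (((FC.obj (TopCat.toSSet.obj (TopCat.of X))).d (n + 1) n).hom c) =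
      dX X n (phi X (n + 1) c) := by
  suffices h : (phi X n).toLinearMap ∘ₗ
      ((FC.obj (TopCat.toSSet.obj (TopCat.of X))).d (n + 1) n).hom =
      dX X n ∘ₗ (phi X (n + 1)).toLinearMap from LinearMap.congr_fun h c
  apply Finsupp.lhom_ext'
  intro σ
  apply LinearMap.ext_ring
  refine (congrArg (phi X n) (FC_d_single _ n σ)).trans ?_
  rw [map_sum]
  change _ = dX X n (phi X (n + 1) (Finsupp.single σ 1))
  rw [phi, phi, Finsupp.domLCongr_single, dX_single]
  refine Finset.sum_congr rfl fun i _ => ?_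
  rw [map_smul, Finsupp.domLCongr_single]
  congr 2
  ext t
  simp only [ContinuousMap.comp_apply, fc, cmbC, ContinuousMap.coe_mk, ← map_eq_cmb]
  rfl

lemma mem_supp_iff_mapDomain {α : Type} (S : Set α) (f : α →₀ ℚ) :
    (∀ x, f x ≠ 0 → x ∈ S) ↔ ∃ a : S →₀ ℚ, Finsupp.mapDomain Subtype.val a = f := by
  classical
  constructor
  · intro h
    refine ⟨f.comapDomain Subtype.val Subtype.val_injective.injOn, ?_⟩
    refine Finsupp.mapDomain_comapDomain _ Subtype.val_injective _ ?_
    intro x hx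
    exact ⟨⟨x, h x (Finsupp.mem_support_iff.1 hx)⟩, rfl⟩
  · rintro ⟨a, rfl⟩ x hx
    have := Finsupp.mapDomain_support (Finsupp.mem_support_iff.2 hx)
    obtain ⟨y, -, rfl⟩ := Finset.mem_image.1 this
    exact y.2

open Simplicial in
lemma phi_small {X : Type} [TopologicalSpace X] (U V : Set X) (n : ℕ)
    (c : (FC.obj (TopCat.toSSet.obj (TopCat.of X))).X n) :
    phi X n c ∈ supp (Sml U V n) ↔ 
      ∃ a : (FC.obj ((AU U ⊔ AU V : (TopCat.toSSet.obj (TopCat.of X)).Subcomplex) : SSet)).X n,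
        ((FC.map (AU U ⊔ AU V).ι).f n).hom a = c := by
  have key : ∀ s : (TopCat.toSSet.obj (TopCat.of X)) _⦋n⦌, s ∈ (AU U ⊔ AU V).obj _ ↔
      Sml U V n (TopCat.toSSetObjEquiv (TopCat.of X) _ s) := by
    intro s
    change (s ∈ (AU U).obj _ ∨ s ∈ (AU V).obj _) ↔ _
    rw [mem_AU, mem_AU]
    rfl
  refine Iff.trans ?_ (mem_supp_iff_mapDomain
    ((AU U ⊔ AU V).obj (Opposite.op (SimplexCategory.mk n))) c)
  rw [supp, Finsupp.mem_supported]
  constructor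
  · intro h x hx
    rw [key]
    apply h
    refine Finset.mem_coe.2 (Finsupp.mem_support_iff.2 ?_)
    exact fun h0 => hx ((domL_apply (TopCat.toSSetObjEquiv (TopCat.of X)
      (Opposite.op (SimplexCategory.mk n))) c x).symm.trans h0)
  · intro h σ hσ
    obtain ⟨s, rfl⟩ := (TopCat.toSSetObjEquiv (TopCat.of X)
      (Opposite.op (SimplexCategory.mk n))).surjective σ
    refine (key s).1 (h s ?_)
    have := Finsupp.mem_support_iff.1 (Finset.mem_coe.1 hσ)
    exact fun h0 => this ((domL_apply (TopCat.toSSetObjEquiv (TopCat.of X)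
      (Opposite.op (SimplexCategory.mk n))) c s).trans h0)

/-- The small simplices short exact sequence. -/
def smallSC {X : Type} [TopologicalSpace X] (U V : Set X) :
    ShortComplex (ChainComplex (ModuleCat.{0} ℚ) ℕ) :=
  ShortComplex.mk (FC.map (AU U ⊔ AU V).ι) (Limits.cokernel.π _) (Limits.cokernel.condition _)

lemma smallSC_exact {X : Type} [TopologicalSpace X] (U V : Set X) : (smallSC U V).ShortExact where
  exact := ShortComplex.exact_cokernel _
  mono_f := FC_mono (AU U ⊔ AU V).ι
  epi_g := by
    dsimp [smallSC]
    infer_instance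

lemma small_step {X : Type} [TopologicalSpace X] {U V : Set X} (hU : IsOpen U) (hV : IsOpen V)
    (hUV : ∀ x, x ∈ U ∨ x ∈ V) (n : ℕ)
    (c : (FC.obj (TopCat.toSSet.obj (TopCat.of X))).X (n + 1))
    (b : (FC.obj ((AU U ⊔ AU V : (TopCat.toSSet.obj (TopCat.of X)).Subcomplex) : SSet)).X n)
    (hb : ((FC.map (AU U ⊔ AU V).ι).f n).hom b =
      ((FC.obj (TopCat.toSSet.obj (TopCat.of X))).d (n + 1) n).hom c) :
    ∃ (e : (FC.obj (TopCat.toSSet.obj (TopCat.of X))).X (n + 2))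
      (a : (FC.obj ((AU U ⊔ AU V : (TopCat.toSSet.obj (TopCat.of X)).Subcomplex) : SSet)).X (n + 1)),
      c = ((FC.obj (TopCat.toSSet.obj (TopCat.of X))).d (n + 2) (n + 1)).hom e +
        ((FC.map (AU U ⊔ AU V).ι).f (n + 1)).hom a := by
  have h1 : phi X n (((FC.obj (TopCat.toSSet.obj (TopCat.of X))).d (n + 1) n).hom c) ∈
    supp (Sml U V n) := (phi_small U V n _).2 ⟨b, hb⟩
  rw [phi_d] at h1
  obtain ⟨e, he⟩ := small_succ hU hV hUV _ h1
  obtain ⟨e, rfl⟩ : ∃ e' : (FC.obj (TopCat.toSSet.obj (TopCat.of X))).X (n + 2),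
    phi X (n + 2) e' = e := (phi X (n+2)).surjective e
  rw [← phi_d] at he
  have he2 : phi X (n + 1) (c - ((FC.obj (TopCat.toSSet.obj (TopCat.of X))).d (n + 2) (n + 1)).hom e)
      ∈ supp (Sml U V (n + 1)) := by
    refine Set.mem_of_eq_of_mem ?_ he
    exact map_sub (phi X (n + 1)) _ _
  obtain ⟨a, ha⟩ := (phi_small U V _ _).1 he2
  refine ⟨e, a, ?_⟩
  rw [ha]
  abel

lemma small_acyclic {X : Type} [TopologicalSpace X] {U V : Set X} (hU : IsOpen U) (hV : IsOpen V)
    (hUV : ∀ x, x ∈ U ∨ x ∈ V) : HasChi (smallSC U V).X₃ 0 := by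
  apply quot_acyclic _ (smallSC_exact U V)
  · intro c
    exact (phi_small U V 0 c).1 (small_zero hUV _)
  · intro n c b hb
    exact small_step hU hV hUV n c b hb

lemma hasChi_small {X : Type} [TopologicalSpace X] {U V : Set X} (hU : IsOpen U) (hV : IsOpen V)
    (hUV : ∀ x, x ∈ U ∨ x ∈ V) {x : ℤ} :
    HasChi (FC.obj ((AU U ⊔ AU V : (TopCat.toSSet.obj (TopCat.of X)).Subcomplex) : SSet)) x ↔
      HC X x := by
  constructor
  · intro h
    have := HasChi.mid _ (smallSC_exact U V) h (small_acyclic hU hV hUV)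
    rw [add_zero] at this
    exact this
  · intro h
    have := HasChi.left _ (smallSC_exact U V) h (small_acyclic hU hV hUV)
    rw [sub_zero] at this
    exact this

theorem HC.mv1 {X : Type} [TopologicalSpace X] {U V : Set X} (hU : IsOpen U) (hV : IsOpen V)
    (hUV : ∀ x, x ∈ U ∨ x ∈ V) {a b c : ℤ} (ha : HC U a) (hb : HC V b) (hc : HC (U ∩ V : Set X) c) :
    HC X (a + b - c) := by
  rw [← hasChi_small hU hV hUV]
  refine FC_mv1 _ _ ((hasChi_AU U).2 ha) ((hasChi_AU V).2 hb) ?_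
  rw [AU_inf]
  exact (hasChi_AU _).2 hc

theorem HC.mv2 {X : Type} [TopologicalSpace X] {U V : Set X} (hU : IsOpen U) (hV : IsOpen V)
    (hUV : ∀ x, x ∈ U ∨ x ∈ V) {x b c : ℤ} (hx : HC X x) (hb : HC V b) (hc : HC (U ∩ V : Set X) c) :
    HC U (x + c - b) := by
  rw [← hasChi_AU]
  refine FC_mv2 _ (AU V) ((hasChi_small hU hV hUV).2 hx) ((hasChi_AU V).2 hb) ?_
  rw [AU_inf]
  exact (hasChi_AU _).2 hc

/-! ### Basic Euler characteristics -/

lemma HC.empty {X : Type} [TopologicalSpace X] [IsEmpty X] : HC X 0 := by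
  apply HasChi.zero_of_exact
  intro n
  apply ShortComplex.exact_of_isZero_X₂
  refine @ModuleCat.isZero_of_subsingleton ℚ _ _ ?_
  have hE : IsEmpty ((TopCat.toSSet.obj (TopCat.of X)).obj (Opposite.op (SimplexCategory.mk n))) := by
    refine ⟨fun s => ?_⟩
    have := TopCat.toSSetObjEquiv (TopCat.of X) _ s
    exact (inferInstance : IsEmpty X).false (this (stdSimplex.vertex (S := ℝ) 0))
  change Subsingleton ((TopCat.toSSet.obj (TopCat.of X)).obj (Opposite.op (SimplexCategory.mk n)) →₀ ℚ)
  infer_instance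

/-- The singular set of a point is constant. -/
def pointIso : TopCat.toSSet.obj (TopCat.of Unit) ≅ (Functor.const SimplexCategoryᵒᵖ).obj PUnit.{1} :=
  NatIso.ofComponents (fun n => Equiv.toIso
    { toFun := fun _ => PUnit.unit
      invFun := fun _ => (TopCat.toSSetObjEquiv (TopCat.of Unit) n).symm ⟨fun _ => (), continuous_const⟩
      left_inv := fun s => (TopCat.toSSetObjEquiv (TopCat.of Unit) n).injective (by ext)
      right_inv := fun _ => rfl }) (by intros; rfl)

/-- Linearization of a constant simplicial set. -/
def pointIso2 : ((SimplicialObject.whiskering _ _).obj (ModuleCat.free ℚ)).obj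
      ((Functor.const SimplexCategoryᵒᵖ).obj PUnit.{1}) ≅
    (Functor.const SimplexCategoryᵒᵖ).obj ((ModuleCat.free ℚ).obj PUnit.{1}) :=
  NatIso.ofComponents (fun _ => Iso.refl _) (by
    intros
    simp
    rfl)

lemma HC.unit : HC Unit 1 := by
  have e1 : FC.obj (TopCat.toSSet.obj (TopCat.of Unit)) ≅
      ChainComplex.alternatingConst.obj ((ModuleCat.free ℚ).obj PUnit.{1}) :=
    (FC.mapIso pointIso).trans (((alternatingFaceMapComplex (ModuleCat.{0} ℚ)).mapIso pointIso2).trans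
      (alternatingFaceMapComplexConst.app ((ModuleCat.free ℚ).obj PUnit.{1})))
  refine HasChi.of_iso e1.symm ?_
  have h0 := ChainComplex.alternatingConstHomologyZero ((ModuleCat.free ℚ).obj PUnit.{1})
  have h1 : ∀ n, n ≠ 0 → Subsingleton
    ((ChainComplex.alternatingConst.obj ((ModuleCat.free ℚ).obj PUnit.{1})).homology n) := by
    intro n hn
    exact ModuleCat.subsingleton_of_isZero
      (ChainComplex.alternatingConst_exactAt _ n hn).isZero_homology
  have h2 : Module.Finite ℚ ((ModuleCat.free ℚ).obj PUnit.{1}) := by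
    change Module.Finite ℚ (PUnit.{1} →₀ ℚ)
    infer_instance
  have h3 : Module.finrank ℚ ((ModuleCat.free ℚ).obj PUnit.{1}) = 1 := by
    change Module.finrank ℚ (PUnit.{1} →₀ ℚ) = 1
    simp
  have := HasChi.of_bdd (ChainComplex.alternatingConst.obj ((ModuleCat.free ℚ).obj PUnit.{1}))
    (fun n => by
      by_cases hn : n = 0
      · subst hn
        exact Module.Finite.equiv h0.symm.toLinearEquiv
      · have := h1 n hn
        infer_instance) 1 (fun M hM => by
      have := h1 M (by omega)
      exact Module.finrank_zero_of_subsingleton)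
  rw [Finset.sum_range_one, h0.toLinearEquiv.finrank_eq, h3] at this
  simpa using this

lemma HC.contractible {X : Type} [TopologicalSpace X] [ContractibleSpace X] : HC X 1 :=
  HC.of_hequiv (ContractibleSpace.hequiv_unit X).some.symm HC.unit

lemma HC.prod_contractible {Y C : Type} [TopologicalSpace Y] [TopologicalSpace C]
    [ContractibleSpace C] {x : ℤ} (h : HC Y x) : HC (Y × C) x :=
  HC.of_hequiv (((ContinuousMap.HomotopyEquiv.refl Y).prodCongr
    (ContractibleSpace.hequiv_unit C).some).symm) (h.of_homeo (Homeomorph.prodPUnit Y).symm)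

/-- Subsets of subsets. -/
def homeoPre {X : Type} [TopologicalSpace X] (A B : Set X) (h : A ⊆ B) :
    (Subtype.val ⁻¹' A : Set B) ≃ₜ A where
  toFun x := ⟨x.1.1, x.2⟩
  invFun x := ⟨⟨x.1, h x.2⟩, x.2⟩
  left_inv _ := rfl
  right_inv _ := rfl
  continuous_toFun := by fun_prop
  continuous_invFun := by fun_prop

lemma HC.mvs1 {X : Type} [TopologicalSpace X] {U V : Set X} (hU : IsOpen U) (hV : IsOpen V)
    {a b c : ℤ} (ha : HC U a) (hb : HC V b) (hc : HC (U ∩ V : Set X) c) :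
    HC (U ∪ V : Set X) (a + b - c) := by
  refine HC.mv1 (X := (U ∪ V : Set X)) (U := Subtype.val ⁻¹' U) (V := Subtype.val ⁻¹' V)
    (hU.preimage continuous_subtype_val) (hV.preimage continuous_subtype_val) (fun x => x.2)
    (ha.of_homeo (homeoPre _ _ Set.subset_union_left).symm)
    (hb.of_homeo (homeoPre _ _ Set.subset_union_right).symm) ?_
  exact hc.of_homeo (homeoPre _ _ (Set.inter_subset_left.trans Set.subset_union_left)).symm

/-- The part of a product over a subset of the second factor. -/
def homeoSnd {Y C : Type} [TopologicalSpace Y] [TopologicalSpace C] (S : Set C) :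
    Y × S ≃ₜ {p : Y × C | p.2 ∈ S} where
  toFun x := ⟨(x.1, x.2.1), x.2.2⟩
  invFun x := (x.1.1, ⟨x.1.2, x.2⟩)
  left_inv _ := rfl
  right_inv _ := rfl
  continuous_toFun := by fun_prop
  continuous_invFun := by fun_prop

lemma HC.slab {Y : Type} [TopologicalSpace Y] {x : ℤ} (h : HC Y x) (S : Set ℂ) {z : ℂ}
    (hz : z ∈ S) (hS : StarConvex ℝ z S) : HC {p : Y × ℂ | p.2 ∈ S} x := by
  have := hS.contractibleSpace ⟨z, hz⟩
  exact (HC.prod_contractible h).of_homeo (homeoSnd S)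

lemma HC.congr_set {X : Type} [TopologicalSpace X] {A B : Set X} (h : A = B) {x : ℤ}
    (hA : HC A x) : HC B x := by
  subst h
  exact hA

lemma slit_inter (z : ℂ) : (z ∈ Complex.slitPlane ∧ -z ∈ Complex.slitPlane) ↔ (0 < z.im ∨ z.im < 0) := by
  simp only [Complex.mem_slitPlane_iff, Complex.neg_re, Complex.neg_im]
  constructor
  · rintro ⟨h1, h2⟩
    rcases lt_trichotomy z.im 0 with h | h | h
    · exact Or.inr h
    · simp [h] at h1 h2
      linarith
    · exact Or.inl h
  · rintro (h | h)
    · exact ⟨Or.inr h.ne', Or.inr (by simpa using h.ne')⟩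
    · exact ⟨Or.inr h.ne, Or.inr (by simpa using h.ne)⟩

lemma slit_union (z : ℂ) : (z ∈ Complex.slitPlane ∨ -z ∈ Complex.slitPlane) ↔ z ≠ 0 := by
  simp only [Complex.mem_slitPlane_iff, Complex.neg_re, Complex.neg_im, ne_eq, Complex.ext_iff,
    Complex.zero_re, Complex.zero_im]
  constructor
  · rintro ((h | h) | (h | h)) ⟨h1, h2⟩
    · linarith
    · exact h h2
    · linarith
    · exact h (by linarith)
  · intro h
    by_cases him : z.im = 0
    · have : z.re ≠ 0 := fun h0 => h ⟨h0, him⟩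
      rcases lt_or_gt_of_ne this with h | h
      · exact Or.inr (Or.inl (by linarith))
      · exact Or.inl (Or.inl h)
    · exact Or.inl (Or.inr him)

/-- The opposite slit plane. -/
def negSlit : Set ℂ := {z : ℂ | -z ∈ Complex.slitPlane}

lemma starConvex_negSlit : StarConvex ℝ (-1) negSlit := by
  intro y hy a b ha hb hab
  have := Complex.starConvex_one_slitPlane (show -y ∈ Complex.slitPlane from hy) ha hb hab
  change -(a • (-1 : ℂ) + b • y) ∈ Complex.slitPlane
  have e : -(a • (-1 : ℂ) + b • y) = a • (1 : ℂ) + b • -y := by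
    simp only [smul_neg]
    ring
  rw [e]
  exact this

/-- Upper half plane. -/
def upH : Set ℂ := {z : ℂ | 0 < z.im}
/-- Lower half plane. -/
def loH : Set ℂ := {z : ℂ | z.im < 0}

/-- Slab over a subset of the plane. -/
def slabS (Y : Type) (S : Set ℂ) : Set (Y × ℂ) := {p | p.2 ∈ S}

lemma slabS_open {Y : Type} [TopologicalSpace Y] {S : Set ℂ} (hS : IsOpen S) :
    IsOpen (slabS Y S) := hS.preimage continuous_snd

lemma HC.puncture {Y : Type} [TopologicalSpace Y] {x : ℤ} (h : HC Y x) :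
    HC {p : Y × ℂ | p.2 ≠ 0} 0 := by
  have hU : HC (slabS Y Complex.slitPlane) x :=
    h.slab _ Complex.one_mem_slitPlane Complex.starConvex_one_slitPlane
  have hV : HC (slabS Y negSlit) x :=
    h.slab _ (z := -1) (show - (-1 : ℂ) ∈ Complex.slitPlane by simp) starConvex_negSlit
  have hI : Complex.I ∈ upH := show 0 < Complex.I.im by simp
  have hI' : -Complex.I ∈ loH := show (-Complex.I).im < 0 by simp
  have hA : HC (slabS Y upH) x := h.slab _ hI ((convex_halfSpace_im_gt 0).starConvex hI)
  have hB : HC (slabS Y loH) x := h.slab _ hI' ((convex_halfSpace_im_lt 0).starConvex hI')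
  have hE : HC (slabS Y upH ∩ slabS Y loH : Set (Y × ℂ)) 0 := by
    have : IsEmpty ↥(slabS Y upH ∩ slabS Y loH : Set (Y × ℂ)) :=
      ⟨fun p => lt_asymm (show 0 < p.1.2.im from p.2.1) (show p.1.2.im < 0 from p.2.2)⟩
    exact HC.empty
  have hAB := HC.mvs1 (slabS_open (isOpen_lt continuous_const Complex.continuous_im))
    (slabS_open (isOpen_lt Complex.continuous_im continuous_const)) hA hB hE
  have hAB' : HC (slabS Y Complex.slitPlane ∩ slabS Y negSlit : Set (Y × ℂ)) (x + x - 0) :=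
    HC.congr_set (by ext p; exact (slit_inter p.2).symm) hAB
  have hT := HC.mvs1 (slabS_open Complex.isOpen_slitPlane)
    (slabS_open (Complex.isOpen_slitPlane.preimage continuous_neg)) hU hV hAB'
  have e : x + x - (x + x - 0) = 0 := by ring
  rw [e] at hT
  exact HC.congr_set (by ext p; exact (slit_union p.2)) hT

/-! ### Complements of affine arrangements, in homogeneous coordinates -/

section arr

/-- The affine arrangement complement in the slice `x0 = 1`. -/
def XS {W κ : Type} [NormedAddCommGroup W] [NormedSpace ℂ W] (x0 : W →L[ℂ] ℂ)
    (f : κ → W →L[ℂ] ℂ) (s : Finset κ) : Set W :=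
  {w | x0 w = 1 ∧ ∀ i ∈ s, f i w ≠ 0}

/-- Kernel of a linear form. -/
abbrev kr {W : Type} [NormedAddCommGroup W] [NormedSpace ℂ W] (l : W →L[ℂ] ℂ) : Submodule ℂ W :=
  LinearMap.ker l.toLinearMap

/-- Restriction of a linear form to the kernel of another one. -/
def rs {W : Type} [NormedAddCommGroup W] [NormedSpace ℂ W] (l g : W →L[ℂ] ℂ) :
    kr l →L[ℂ] ℂ := g.comp (kr l).subtypeL

lemma rs_apply {W : Type} [NormedAddCommGroup W] [NormedSpace ℂ W] (l g : W →L[ℂ] ℂ) (w : kr l) :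
    rs l g w = g w.1 := rfl

lemma kr_apply {W : Type} [NormedAddCommGroup W] [NormedSpace ℂ W] (l : W →L[ℂ] ℂ) (w : kr l) :
    l w.1 = 0 := w.2

/-- Radius of the tube. -/
def eps {W κ : Type} [NormedAddCommGroup W] [NormedSpace ℂ W] 
    (f : κ → W →L[ℂ] ℂ) (s : Finset κ) (v y : W) : ℝ :=
  ∏ i ∈ s, min 1 (‖f i y‖ / (1 + ‖f i v‖))

lemma eps_cont {W κ : Type} [NormedAddCommGroup W] [NormedSpace ℂ W] 
    (f : κ → W →L[ℂ] ℂ) (s : Finset κ) (v : W) : Continuous (eps f s v) := by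
  unfold eps
  refine continuous_finset_prod _ fun i _ => ?_
  refine continuous_const.min ?_
  exact ((f i).continuous.norm).div_const _

lemma eps_pos {W κ : Type} [NormedAddCommGroup W] [NormedSpace ℂ W] 
    (f : κ → W →L[ℂ] ℂ) (s : Finset κ) (v y : W) (h : ∀ i ∈ s, f i y ≠ 0) : 0 < eps f s v y := by
  refine Finset.prod_pos fun i hi => lt_min one_pos ?_
  have := norm_pos_iff.2 (h i hi)
  positivity

lemma eps_nonneg {W κ : Type} [NormedAddCommGroup W] [NormedSpace ℂ W] 
    (f : κ → W →L[ℂ] ℂ) (s : Finset κ) (v y : W) : 0 ≤ eps f s v y := by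
  refine Finset.prod_nonneg fun i hi => le_min zero_le_one ?_
  positivity

lemma eps_le {W κ : Type} [NormedAddCommGroup W] [NormedSpace ℂ W] 
    (f : κ → W →L[ℂ] ℂ) (s : Finset κ) (v y : W) {i : κ} (hi : i ∈ s) :
    eps f s v y * (1 + ‖f i v‖) ≤ ‖f i y‖ := by
  classical
  have hp : 0 < 1 + ‖f i v‖ := by positivity
  rw [← le_div_iff₀ hp]
  unfold eps
  rw [← Finset.mul_prod_erase _ _ hi]
  have h1 : ∏ x ∈ s.erase i, min 1 (‖f x y‖ / (1 + ‖f x v‖)) ≤ 1 :=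
    Finset.prod_le_one (fun j _ => le_min zero_le_one (by positivity)) fun j _ => min_le_left _ _
  have h0 : 0 ≤ min 1 (‖f i y‖ / (1 + ‖f i v‖)) := le_min zero_le_one (by positivity)
  calc _ ≤ min 1 (‖f i y‖ / (1 + ‖f i v‖)) * 1 := mul_le_mul_of_nonneg_left h1 h0
    _ ≤ _ := by rw [mul_one]; exact min_le_right _ _

lemma tube_ne {W κ : Type} [NormedAddCommGroup W] [NormedSpace ℂ W] 
    (f : κ → W →L[ℂ] ℂ) (s : Finset κ) (v y : W) {r : ℂ} (hr : ‖r‖ < eps f s v y)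
    {i : κ} (hi : i ∈ s) : f i (y + r • v) ≠ 0 := by
  intro h
  rw [map_add, map_smul, smul_eq_mul] at h
  have h1 : ‖f i y‖ = ‖r‖ * ‖f i v‖ := by
    rw [← norm_mul, eq_neg_of_add_eq_zero_left h, norm_neg]
  have h2 := eps_le f s v y hi
  have hp : 0 < 1 + ‖f i v‖ := by positivity
  have h3 := mul_lt_mul_of_pos_right hr hp
  nlinarith [norm_nonneg r, norm_nonneg (f i v)]

lemma tube_ne' {W κ : Type} [NormedAddCommGroup W] [NormedSpace ℂ W] 
    (f : κ → W →L[ℂ] ℂ) (s : Finset κ) (v y : W) (hr : 0 < eps f s v y)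
    {i : κ} (hi : i ∈ s) : f i y ≠ 0 := by
  have := tube_ne f s v y (r := 0) (by simpa using hr) hi
  simpa using this

/-- Projection along `v`. -/
def pr {W : Type} [NormedAddCommGroup W] [NormedSpace ℂ W] (l : W →L[ℂ] ℂ) (v w : W) : W :=
  w - l w • v

lemma pr_cont {W : Type} [NormedAddCommGroup W] [NormedSpace ℂ W] (l : W →L[ℂ] ℂ) (v : W) :
    Continuous (pr l v) := by
  unfold pr
  fun_prop

lemma pr_mem {W : Type} [NormedAddCommGroup W] [NormedSpace ℂ W] (l : W →L[ℂ] ℂ) {v : W}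
    (hv : l v = 1) (w : W) : pr l v w ∈ kr l := by
  change l (w - l w • v) = 0
  simp [hv]

lemma pr_add {W : Type} [NormedAddCommGroup W] [NormedSpace ℂ W] (l : W →L[ℂ] ℂ) {v : W}
    (hv : l v = 1) (y : kr l) (r : ℂ) : pr l v (y.1 + r • v) = y.1 := by
  unfold pr
  rw [map_add, kr_apply, map_smul, hv]
  simp

lemma pr_self {W : Type} [NormedAddCommGroup W] [NormedSpace ℂ W] (l : W →L[ℂ] ℂ) (v w : W) :
    pr l v w + l w • v = w := by
  unfold pr; simp

/-- The tube. -/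
def tubeV {W κ : Type} [NormedAddCommGroup W] [NormedSpace ℂ W] (x0 : W →L[ℂ] ℂ)
    (f : κ → W →L[ℂ] ℂ) (s : Finset κ) (l : W →L[ℂ] ℂ) (v : W) : Set (XS x0 f s) :=
  {w | ‖l w.1‖ < eps f s v (pr l v w.1)}

/-- The restricted complement. -/
abbrev XR {W κ : Type} [NormedAddCommGroup W] [NormedSpace ℂ W] (x0 : W →L[ℂ] ℂ)
    (f : κ → W →L[ℂ] ℂ) (s : Finset κ) (l : W →L[ℂ] ℂ) : Set (kr l) :=
  XS (rs l x0) (fun i => rs l (f i)) s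

lemma norm_tube {e : ℝ} (he : 0 < e) (t : ℂ) : ‖((e / (1 + ‖t‖) : ℝ) : ℂ) * t‖ < e := by
  have hp : 0 < 1 + ‖t‖ := by positivity
  rw [norm_mul, Complex.norm_real, Real.norm_of_nonneg (by positivity), div_mul_eq_mul_div,
    div_lt_iff₀ hp]
  nlinarith

lemma tube_inv1 {e : ℝ} (he : 0 < e) (t : ℂ) :
    (((e - ‖((e / (1 + ‖t‖) : ℝ) : ℂ) * t‖)⁻¹ : ℝ) : ℂ) * (((e / (1 + ‖t‖) : ℝ) : ℂ) * t) = t := by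
  have hp : 0 < 1 + ‖t‖ := by positivity
  rw [norm_mul, Complex.norm_real, Real.norm_of_nonneg (by positivity), ← mul_assoc,
    ← Complex.ofReal_mul]
  have : (e - e / (1 + ‖t‖) * ‖t‖)⁻¹ * (e / (1 + ‖t‖)) = 1 := by
    have h : e - e / (1 + ‖t‖) * ‖t‖ = e / (1 + ‖t‖) := by field_simp; ring
    rw [h]
    exact inv_mul_cancel₀ (by positivity)
  rw [this]
  simp

lemma tube_inv2 {e : ℝ} (t : ℂ) (ht : ‖t‖ < e) :
    (((e / (1 + ‖(((e - ‖t‖)⁻¹ : ℝ) : ℂ) * t‖) : ℝ) : ℂ) * ((((e - ‖t‖)⁻¹ : ℝ) : ℂ) * t)) = t := by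
  have he : 0 < e - ‖t‖ := by linarith
  have he' : 0 < e := lt_of_le_of_lt (norm_nonneg _) ht
  rw [norm_mul, Complex.norm_real, Real.norm_of_nonneg (by positivity), ← mul_assoc,
    ← Complex.ofReal_mul]
  have : (e / (1 + (e - ‖t‖)⁻¹ * ‖t‖)) * (e - ‖t‖)⁻¹ = 1 := by
    have h : 1 + (e - ‖t‖)⁻¹ * ‖t‖ = e / (e - ‖t‖) := by field_simp; ring
    rw [h]
    field_simp
  rw [this]
  simp

/-- The tube is a trivial bundle. -/
def tubeHomeo {W κ : Type} [NormedAddCommGroup W] [NormedSpace ℂ W] (x0 : W →L[ℂ] ℂ)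
    (f : κ → W →L[ℂ] ℂ) (s : Finset κ) (l : W →L[ℂ] ℂ) (v : W) (hv : l v = 1) (hx : x0 v = 0) :
    XR x0 f s l × ℂ ≃ₜ tubeV x0 f s l v where
  toFun p := ⟨⟨p.1.1.1 + (((eps f s v p.1.1.1 / (1 + ‖p.2‖) : ℝ) : ℂ) * p.2) • v, by
      rw [map_add, map_smul, hx, smul_zero, add_zero]; exact p.1.2.1,
      fun i hi => tube_ne f s v _ (norm_tube (eps_pos f s v _ p.1.2.2) _) hi⟩, by
      change ‖l _‖ < eps f s v (pr l v _)
      rw [pr_add l hv, map_add, kr_apply, map_smul, hv, zero_add, smul_eq_mul, mul_one]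
      exact norm_tube (eps_pos f s v _ p.1.2.2) _⟩
  invFun w := (⟨⟨pr l v w.1.1, pr_mem l hv _⟩, by
      change x0 (w.1.1 - l w.1.1 • v) = 1
      rw [map_sub, map_smul, hx, smul_zero, sub_zero]; exact w.1.2.1, fun i hi =>
      tube_ne' f s v _ (lt_of_le_of_lt (norm_nonneg _) w.2) hi⟩,
      (((eps f s v (pr l v w.1.1) - ‖l w.1.1‖)⁻¹ : ℝ) : ℂ) * l w.1.1)
  left_inv p := by
    refine Prod.ext (Subtype.ext (Subtype.ext ?_)) ?_
    · exact pr_add l hv _ _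
    · dsimp only
      rw [pr_add l hv, map_add, kr_apply, map_smul, hv, zero_add, smul_eq_mul, mul_one]
      exact tube_inv1 (eps_pos f s v _ p.1.2.2) _
  right_inv w := by
    refine Subtype.ext (Subtype.ext ?_)
    dsimp only
    rw [tube_inv2 _ w.2]
    exact pr_self l v _
  continuous_toFun := by
    have h1 : Continuous fun p : XR x0 f s l × ℂ => eps f s v p.1.1.1 :=
      (eps_cont f s v).comp (by fun_prop)
    have h2 : Continuous fun p : XR x0 f s l × ℂ => eps f s v p.1.1.1 / (1 + ‖p.2‖) :=
      h1.div (by fun_prop) (fun p => by positivity)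
    refine Continuous.subtype_mk (Continuous.subtype_mk ?_ _) _
    refine Continuous.add (by fun_prop) (Continuous.smul ?_ continuous_const)
    exact (Complex.continuous_ofReal.comp h2).mul continuous_snd
  continuous_invFun := by
    have h1 : Continuous fun w : tubeV x0 f s l v => pr l v w.1.1 :=
      (pr_cont l v).comp (by fun_prop)
    have h2 : Continuous fun w : tubeV x0 f s l v => eps f s v (pr l v w.1.1) :=
      (eps_cont f s v).comp h1
    have h3 : Continuous fun w : tubeV x0 f s l v => l w.1.1 := l.continuous.comp (by fun_prop)
    refine Continuous.prodMk (Continuous.subtype_mk (Continuous.subtype_mk h1 _) _) ?_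
    refine Continuous.mul (Complex.continuous_ofReal.comp (Continuous.inv₀ (h2.sub h3.norm) ?_)) h3
    intro w
    have : ‖l w.1.1‖ < eps f s v (pr l v w.1.1) := w.2
    exact (sub_pos.2 this).ne'

/-- Removing one more hyperplane. -/
def insHomeo {W κ : Type} [NormedAddCommGroup W] [NormedSpace ℂ W] [DecidableEq κ] (x0 : W →L[ℂ] ℂ)
    (f : κ → W →L[ℂ] ℂ) (s : Finset κ) (l : κ) :
    {w : XS x0 f s | f l w.1 ≠ 0} ≃ₜ XS x0 f (insert l s) where
  toFun w := ⟨w.1.1, w.1.2.1, fun i hi => by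
    rcases Finset.mem_insert.1 hi with rfl | h
    · exact w.2
    · exact w.1.2.2 i h⟩
  invFun w := ⟨⟨w.1, w.2.1, fun i hi => w.2.2 i (Finset.mem_insert_of_mem hi)⟩,
    w.2.2 l (Finset.mem_insert_self _ _)⟩
  left_inv _ := rfl
  right_inv _ := rfl
  continuous_toFun := by fun_prop
  continuous_invFun := by fun_prop

/-- Intersections as subsets of subsets. -/
def homeoPre2 {X : Type} [TopologicalSpace X] (A B : Set X) :
    {x : B | x.1 ∈ A} ≃ₜ (A ∩ B : Set X) where
  toFun x := ⟨x.1.1, x.2, x.1.2⟩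
  invFun x := ⟨⟨x.1, x.2.2⟩, x.2.1⟩
  left_inv _ := rfl
  right_inv _ := rfl
  continuous_toFun := by fun_prop
  continuous_invFun := by fun_prop

/-- Deletion-restriction for Euler characteristics. -/
theorem HC.delres {W κ : Type} [NormedAddCommGroup W] [NormedSpace ℂ W] [DecidableEq κ]
    (x0 : W →L[ℂ] ℂ) (f : κ → W →L[ℂ] ℂ) (s : Finset κ) (l : κ) (v : W) (hv : f l v = 1)
    (hx : x0 v = 0) {a b : ℤ} (ha : HC (XS x0 f s) a) (hb : HC (XR x0 f s (f l)) b) :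
    HC (XS x0 f (insert l s)) (a - b) := by
  have hU : IsOpen {w : XS x0 f s | f l w.1 ≠ 0} :=
    isOpen_ne_fun ((f l).continuous.comp continuous_subtype_val) continuous_const
  have hV : IsOpen (tubeV x0 f s (f l) v) :=
    isOpen_lt ((f l).continuous.comp continuous_subtype_val).norm
      ((eps_cont f s v).comp ((pr_cont (f l) v).comp continuous_subtype_val))
  have hcov : ∀ w : XS x0 f s, w ∈ {w : XS x0 f s | f l w.1 ≠ 0} ∨ w ∈ tubeV x0 f s (f l) v := by
    intro w
    by_cases h : f l w.1 = 0
    · right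
      change ‖f l w.1‖ < eps f s v (w.1 - f l w.1 • v)
      rw [h, norm_zero, zero_smul, sub_zero]
      exact eps_pos f s v _ w.2.2
    · exact Or.inl h
  have h1 : HC (tubeV x0 f s (f l) v) b :=
    (HC.prod_contractible hb).of_homeo (tubeHomeo x0 f s (f l) v hv hx)
  have h2 : HC {w : tubeV x0 f s (f l) v | f l w.1.1 ≠ 0} 0 := by
    refine (HC.puncture hb).of_homeo ((tubeHomeo x0 f s (f l) v hv hx).subtype ?_)
    intro p
    change p.2 ≠ 0 ↔ f l (p.1.1.1 + (((eps f s v p.1.1.1 / (1 + ‖p.2‖) : ℝ) : ℂ) * p.2) • v) ≠ 0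
    rw [map_add, kr_apply, map_smul, hv, zero_add, smul_eq_mul, mul_one]
    have h3 := eps_pos f s v _ p.1.2.2
    have h4 : ((eps f s v p.1.1.1 / (1 + ‖p.2‖) : ℝ) : ℂ) ≠ 0 :=
      Complex.ofReal_ne_zero.2 (div_pos h3 (by positivity)).ne'
    rw [mul_ne_zero_iff]
    exact ⟨fun h => ⟨h4, h⟩, fun h => h.2⟩
  have h3 : HC ({w : XS x0 f s | f l w.1 ≠ 0} ∩ tubeV x0 f s (f l) v : Set (XS x0 f s)) 0 := by
    have := h2.of_homeo (homeoPre2 {w : XS x0 f s | f l w.1 ≠ 0} (tubeV x0 f s (f l) v))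
    exact this
  have := HC.mv2 hU hV hcov ha h1 h3
  rw [add_zero] at this
  exact this.of_homeo (insHomeo x0 f s l)

end arr

lemma dichotomy {W : Type} [NormedAddCommGroup W] [NormedSpace ℂ W] (x0 l : W →L[ℂ] ℂ) :
    (∃ c : ℂ, l = c • x0) ∨ ∃ v, l v = 1 ∧ x0 v = 0 := by
  by_cases h : ∃ v, x0 v = 0 ∧ l v ≠ 0
  · obtain ⟨v, h1, h2⟩ := h
    exact Or.inr ⟨(l v)⁻¹ • v, by simp [h2], by simp [h1]⟩
  · push Not at h
    left
    by_cases hx : ∃ u, x0 u ≠ 0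
    · obtain ⟨u, hu⟩ := hx
      refine ⟨l u / x0 u, ?_⟩
      ext w
      have h1 := h (w - (x0 w / x0 u) • u) (by simp [hu])
      rw [map_sub, map_smul, sub_eq_zero, smul_eq_mul] at h1
      rw [h1]
      simp only [ContinuousLinearMap.smul_apply, smul_eq_mul]
      ring
    · push Not at hx
      exact ⟨0, by ext w; simp [h w (hx w)]⟩

theorem HC.exists_arr {κ : Type} [DecidableEq κ] (s : Finset κ) :
    ∀ {W : Type} [NormedAddCommGroup W] [NormedSpace ℂ W] (x0 : W →L[ℂ] ℂ) (f : κ → W →L[ℂ] ℂ),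
      ∃ a, HC (XS x0 f s) a := by
  induction s using Finset.induction_on with
  | empty =>
    intro W _ _ x0 f
    by_cases h : (XS x0 f ∅).Nonempty
    · have hc : Convex ℝ (XS x0 f ∅) := by
        intro x hx y hy a b ha hb hab
        refine ⟨?_, fun i hi => absurd hi (Finset.notMem_empty i)⟩
        have hx1 : x0 x = 1 := hx.1
        have hy1 : x0 y = 1 := hy.1
        rw [map_add, ContinuousLinearMap.map_smul_of_tower, ContinuousLinearMap.map_smul_of_tower,
          hx1, hy1, ← add_smul, hab, one_smul]
      have := hc.contractibleSpace h
      exact ⟨1, HC.contractible⟩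
    · have : IsEmpty (XS x0 f ∅) := ⟨fun x => h ⟨x.1, x.2⟩⟩
      exact ⟨0, HC.empty⟩
  | insert l s hl ih =>
    intro W _ _ x0 f
    rcases dichotomy x0 (f l) with ⟨c, hc⟩ | ⟨v, hv, hx⟩
    · by_cases h0 : c = 0
      · have : IsEmpty (XS x0 f (insert l s)) :=
          ⟨fun x => x.2.2 l (Finset.mem_insert_self _ _) (by rw [hc, h0]; simp)⟩
        exact ⟨0, HC.empty⟩
      · obtain ⟨a, ha⟩ := ih x0 f
        refine ⟨a, HC.congr_set ?_ ha⟩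
        ext w
        refine and_congr_right fun hw => ?_
        rw [Finset.forall_mem_insert]
        have : f l w ≠ 0 := by rw [hc]; simp [hw, h0]
        exact ⟨fun h => ⟨this, h⟩, fun h => h.2⟩
    · obtain ⟨a, ha⟩ := ih x0 f
      obtain ⟨b, hb⟩ := ih (rs (f l) x0) (fun i => rs (f l) (f i))
      exact ⟨a - b, HC.delres x0 f s l v hv hx ha hb⟩

/-- Product structure along a common direction. -/
def coloopHomeo1 {W κ : Type} [NormedAddCommGroup W] [NormedSpace ℂ W]
    (x0 : W →L[ℂ] ℂ) (f : κ → W →L[ℂ] ℂ) (s : Finset κ) (l : W →L[ℂ] ℂ) (v : W) (hv : l v = 1)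
    (hx : x0 v = 0) (hs : ∀ i ∈ s, f i v = 0) : XR x0 f s l × ℂ ≃ₜ XS x0 f s where
  toFun p := ⟨p.1.1.1 + p.2 • v, by
      rw [map_add, map_smul, hx, smul_zero, add_zero]; exact p.1.2.1, fun i hi => by
      rw [map_add, map_smul, hs i hi, smul_zero, add_zero]; exact p.1.2.2 i hi⟩
  invFun w := (⟨⟨pr l v w.1, pr_mem l hv _⟩, by
      change x0 (w.1 - l w.1 • v) = 1
      rw [map_sub, map_smul, hx, smul_zero, sub_zero]; exact w.2.1, fun i hi => by
      change f i (w.1 - l w.1 • v) ≠ 0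
      rw [map_sub, map_smul, hs i hi, smul_zero, sub_zero]; exact w.2.2 i hi⟩, l w.1)
  left_inv p := by
    refine Prod.ext (Subtype.ext (Subtype.ext ?_)) ?_
    · exact pr_add l hv _ _
    · dsimp only
      rw [map_add, kr_apply, map_smul, hv, zero_add, smul_eq_mul, mul_one]
  right_inv w := Subtype.ext (pr_self l v _)
  continuous_toFun := by fun_prop
  continuous_invFun := by
    have h1 : Continuous fun w : XS x0 f s => pr l v w.1 := (pr_cont l v).comp (by fun_prop)
    have h3 : Continuous fun w : XS x0 f s => l w.1 := l.continuous.comp (by fun_prop)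
    exact Continuous.prodMk (Continuous.subtype_mk (Continuous.subtype_mk h1 _) _) h3

theorem HC.coloop1 {W κ : Type} [NormedAddCommGroup W] [NormedSpace ℂ W] [DecidableEq κ]
    (x0 : W →L[ℂ] ℂ) (f : κ → W →L[ℂ] ℂ) (s : Finset κ) (l : κ) (v : W) (hv : f l v = 1)
    (hx : x0 v = 0) (hs : ∀ i ∈ s, f i v = 0) : HC (XS x0 f (insert l s)) 0 := by
  obtain ⟨b, hb⟩ := HC.exists_arr s (rs (f l) x0) (fun i => rs (f l) (f i))
  have h := HC.delres x0 f s l v hv hx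
    ((HC.prod_contractible hb).of_homeo (coloopHomeo1 x0 f s (f l) v hv hx hs)) hb
  rwa [sub_self] at h

/-- Product structure for central arrangements. -/
def coloopHomeo2 {W κ : Type} [NormedAddCommGroup W] [NormedSpace ℂ W]
    (x0 : W →L[ℂ] ℂ) (f : κ → W →L[ℂ] ℂ) (s : Finset κ) (v : W) (hv : x0 v = 1)
    (hs : ∀ i ∈ s, f i v = 0) (j : κ) (hj : j ∈ s) :
    {p : XS (rs x0 (f j)) (fun i => rs x0 (f i)) s × ℂ | p.2 ≠ 0} ≃ₜ XS x0 f s where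
  toFun p := ⟨v + p.1.2 • p.1.1.1.1, by
      rw [map_add, map_smul, kr_apply, hv, smul_zero, add_zero], fun i hi => by
      rw [map_add, map_smul, hs i hi, zero_add, smul_eq_mul]
      exact mul_ne_zero p.2 (p.1.1.2.2 i hi)⟩
  invFun w := ⟨(⟨⟨(f j w.1)⁻¹ • (w.1 - v), by
        change x0 _ = 0
        rw [map_smul, map_sub, hv, show x0 w.1 = 1 from w.2.1, sub_self, smul_zero]⟩, by
        change f j ((f j w.1)⁻¹ • (w.1 - v)) = 1
        rw [map_smul, map_sub, hs j hj, sub_zero, smul_eq_mul]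
        exact inv_mul_cancel₀ (w.2.2 j hj), fun i hi => by
        change f i ((f j w.1)⁻¹ • (w.1 - v)) ≠ 0
        rw [map_smul, map_sub, hs i hi, sub_zero, smul_eq_mul]
        exact mul_ne_zero (inv_ne_zero (w.2.2 j hj)) (w.2.2 i hi)⟩, f j w.1), w.2.2 j hj⟩
  left_inv p := by
    have h1 : f j p.1.1.1.1 = 1 := p.1.1.2.1
    have h2 : f j (v + p.1.2 • p.1.1.1.1) = p.1.2 := by
      rw [map_add, map_smul, hs j hj, zero_add, smul_eq_mul, h1, mul_one]
    refine Subtype.ext (Prod.ext (Subtype.ext (Subtype.ext ?_)) h2)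
    dsimp only
    rw [h2, add_sub_cancel_left, smul_smul, inv_mul_cancel₀ p.2, one_smul]
  right_inv w := by
    refine Subtype.ext ?_
    dsimp only
    rw [smul_smul, mul_inv_cancel₀ (w.2.2 j hj), one_smul, add_sub_cancel]
  continuous_toFun := by fun_prop
  continuous_invFun := by
    have h3 : Continuous fun w : XS x0 f s => f j w.1 := (f j).continuous.comp (by fun_prop)
    refine Continuous.subtype_mk (Continuous.prodMk (Continuous.subtype_mk
      (Continuous.subtype_mk ?_ _) _) h3) _
    exact (h3.inv₀ fun w => w.2.2 j hj).smul (by fun_prop)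

theorem HC.coloop2 {W κ : Type} [NormedAddCommGroup W] [NormedSpace ℂ W] [DecidableEq κ]
    (x0 : W →L[ℂ] ℂ) (f : κ → W →L[ℂ] ℂ) (s : Finset κ) (v : W) (hv : x0 v = 1)
    (hs : ∀ i ∈ s, f i v = 0) (j : κ) (hj : j ∈ s) : HC (XS x0 f s) 0 := by
  obtain ⟨b, hb⟩ := HC.exists_arr s (rs x0 (f j)) (fun i => rs x0 (f i))
  exact (HC.puncture hb).of_homeo (coloopHomeo2 x0 f s v hv hs j hj)

/-! ### Independent reciprocal monomials -/

/-- Reciprocal monomial. -/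
def mon {W κ : Type} [NormedAddCommGroup W] [NormedSpace ℂ W] (f : κ → W →L[ℂ] ℂ) (s : Finset κ)
    (a : κ →₀ ℕ) (w : W) : ℂ := ∏ i ∈ s, ((f i w)⁻¹) ^ (a i)

/-- Linear independence of reciprocal monomials. -/
def Ind {W κ : Type} [NormedAddCommGroup W] [NormedSpace ℂ W] (f : κ → W →L[ℂ] ℂ) (s : Finset κ)
    (B : Finset (κ →₀ ℕ)) : Prop :=
  ∀ c : (κ →₀ ℕ) → ℂ, (∀ w, (∀ i ∈ s, f i w ≠ 0) → ∑ a ∈ B, c a * mon f s a w = 0) →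
    ∀ a ∈ B, c a = 0

/-- Gluing of exponent sets. -/
def Bb {κ : Type} [DecidableEq κ] (l : κ) (Bs : ℕ → Finset (κ →₀ ℕ)) (q : ℕ) : Finset (κ →₀ ℕ) :=
  (Finset.range (q + 1)).biUnion fun j => (Bs j).image (· + Finsupp.single l j)

lemma Bb_sum {κ : Type} [DecidableEq κ] (l : κ) (Bs : ℕ → Finset (κ →₀ ℕ)) (q : ℕ)
    (hl : ∀ j, ∀ a ∈ Bs j, a l = 0) {M : Type} [AddCommMonoid M] (g : (κ →₀ ℕ) → M) :
    ∑ a ∈ Bb l Bs q, g a =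
      ∑ j ∈ Finset.range (q + 1), ∑ a ∈ Bs j, g (a + Finsupp.single l j) := by
  unfold Bb
  rw [Finset.sum_biUnion]
  · refine Finset.sum_congr rfl fun j _ => ?_
    rw [Finset.sum_image]
    intro a _ b _ h
    exact add_right_cancel h
  · intro i _ j _ hij
    rw [Function.onFun, Finset.disjoint_left]
    intro x hx hy
    obtain ⟨a, ha, rfl⟩ := Finset.mem_image.1 hx
    obtain ⟨b, hb, hab⟩ := Finset.mem_image.1 hy
    have := congrArg (fun z => z l) hab
    simp [hl i a ha, hl j b hb] at this
    exact hij this.symm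

lemma mon_insert {W κ : Type} [NormedAddCommGroup W] [NormedSpace ℂ W] [DecidableEq κ]
    (f : κ → W →L[ℂ] ℂ) (s : Finset κ) (l : κ) (hl : l ∉ s) (a : κ →₀ ℕ) (ha : a l = 0) (j : ℕ)
    (w : W) : mon f (insert l s) (a + Finsupp.single l j) w = mon f s a w * ((f l w)⁻¹) ^ j := by
  unfold mon
  rw [Finset.prod_insert hl, mul_comm]
  congr 1
  · refine Finset.prod_congr rfl fun i hi => ?_
    have : l ≠ i := fun h => hl (h ▸ hi)
    simp [Finsupp.single_apply, this]
  · simp [ha]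

lemma mon_contAt {W κ : Type} [NormedAddCommGroup W] [NormedSpace ℂ W]
    (f : κ → W →L[ℂ] ℂ) (s : Finset κ) (a : κ →₀ ℕ) (w : W) (hw : ∀ i ∈ s, f i w ≠ 0) :
    ContinuousAt (mon f s a) w := by
  unfold mon
  refine tendsto_finsetProd _ fun i hi => ?_
  exact (((f i).continuous.continuousAt).inv₀ (hw i hi)).pow _

lemma pole (J : ℕ) (F : ℕ → ℂ → ℂ) (hF : ∀ j, ContinuousAt (F j) 0)
    (h : ∀ᶠ t in nhdsWithin (0 : ℂ) {0}ᶜ, ∑ j ∈ Finset.range (J + 1), F j t * (t⁻¹) ^ j = 0) :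
    F J 0 = 0 := by
  have hG : ContinuousAt (fun t => ∑ j ∈ Finset.range (J + 1), F j t * t ^ (J - j)) 0 := by
    refine tendsto_finsetSum _ fun j _ => ?_
    exact (hF j).mul (continuousAt_id.pow _)
  have h1 : ∀ᶠ t in nhdsWithin (0 : ℂ) {0}ᶜ,
      ∑ j ∈ Finset.range (J + 1), F j t * t ^ (J - j) = 0 := by
    filter_upwards [h, self_mem_nhdsWithin] with t ht ht0
    have ht0 : t ≠ 0 := ht0
    have : ∑ j ∈ Finset.range (J + 1), F j t * t ^ (J - j) =
        t ^ J * ∑ j ∈ Finset.range (J + 1), F j t * (t⁻¹) ^ j := by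
      rw [Finset.mul_sum]
      refine Finset.sum_congr rfl fun j hj => ?_
      have hj : j ≤ J := Nat.lt_succ_iff.1 (Finset.mem_range.1 hj)
      rw [pow_sub₀ t ht0 hj, inv_pow]
      ring
    rw [this, ht, mul_zero]
  have h2 : Filter.Tendsto (fun t => ∑ j ∈ Finset.range (J + 1), F j t * t ^ (J - j))
      (nhdsWithin (0 : ℂ) {0}ᶜ) (nhds 0) :=
    Filter.Tendsto.congr' (h1.mono fun t ht => ht.symm) tendsto_const_nhds
  have h3 := tendsto_nhds_unique (hG.tendsto.mono_left nhdsWithin_le_nhds) h2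
  rw [Finset.sum_range_succ, Finset.sum_eq_zero, zero_add, Nat.sub_self, pow_zero, mul_one] at h3
  · exact h3
  · intro j hj
    have : J - j ≠ 0 := by have := Finset.mem_range.1 hj; omega
    rw [zero_pow this, mul_zero]

lemma ind_step {W κ : Type} [NormedAddCommGroup W] [NormedSpace ℂ W] [DecidableEq κ]
    (f : κ → W →L[ℂ] ℂ) (s : Finset κ) (l : κ) (hl : l ∉ s) (v : W) (hv : f l v = 1)
    (Bs : ℕ → Finset (κ →₀ ℕ)) (q : ℕ) (hB : ∀ j, ∀ a ∈ Bs j, a l = 0)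
    (h0 : Ind f s (Bs 0)) (h1 : ∀ j, j ≠ 0 → Ind (fun i => rs (f l) (f i)) s (Bs j)) :
    Ind f (insert l s) (Bb l Bs q) := by
  intro c hc
  suffices H : ∀ n j, q - j = n → j ≤ q → ∀ a ∈ Bs j, c (a + Finsupp.single l j) = 0 by
    intro a ha
    obtain ⟨j, hj, ha⟩ := Finset.mem_biUnion.1 ha
    obtain ⟨b, hb, rfl⟩ := Finset.mem_image.1 ha
    exact H _ j rfl (Nat.lt_succ_iff.1 (Finset.mem_range.1 hj)) b hb
  intro n
  induction n using Nat.strong_induction_on with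
  | _ n ih =>
  intro j hjn hjq
  have hz : ∀ k, j < k → k ≤ q → ∀ a ∈ Bs k, c (a + Finsupp.single l k) = 0 :=
    fun k hk hkq => ih (q - k) (by omega) k rfl hkq
  have hsum : ∀ w, (∀ i ∈ s, f i w ≠ 0) → f l w ≠ 0 → ∑ k ∈ Finset.range (j + 1),
      (∑ a ∈ Bs k, c (a + Finsupp.single l k) * mon f s a w) * ((f l w)⁻¹) ^ k = 0 := by
    intro w hw hlw
    have := hc w (by
      intro i hi
      rcases Finset.mem_insert.1 hi with rfl | hi
      · exact hlw
      · exact hw i hi)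
    rw [Bb_sum l Bs q hB] at this
    rw [← this]
    have hsub : Finset.range (j + 1) ⊆ Finset.range (q + 1) := by
      intro x; simp only [Finset.mem_range]; omega
    rw [← Finset.sum_subset hsub]
    · refine Finset.sum_congr rfl fun k _ => ?_
      rw [Finset.sum_mul]
      refine Finset.sum_congr rfl fun a ha => ?_
      rw [mon_insert f s l hl a (hB k a ha), mul_assoc]
    · intro k hk hk'
      simp only [Finset.mem_range] at hk hk'
      refine Finset.sum_eq_zero fun a ha => ?_
      rw [hz k (by omega) (by omega) a ha, zero_mul]
  have hker : ∀ y, (∀ i ∈ s, f i y ≠ 0) → f l y = 0 →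
      ∑ a ∈ Bs j, c (a + Finsupp.single l j) * mon f s a y = 0 := by
    intro y hy hly
    have hline : Continuous fun t : ℂ => y + t • v := by fun_prop
    have hp := pole j (fun k t => ∑ a ∈ Bs k, c (a + Finsupp.single l k) * mon f s a (y + t • v))
      (fun k => by
        refine tendsto_finsetSum _ fun a _ => ?_
        refine Filter.Tendsto.mul tendsto_const_nhds ?_
        have h2 : ContinuousAt (mon f s a) (y + (0 : ℂ) • v) := by
          rw [zero_smul, add_zero]; exact mon_contAt f s a y hy
        exact ContinuousAt.comp (f := fun t : ℂ => y + t • v) h2 hline.continuousAt) (by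
        have hev : ∀ᶠ t in nhds (0 : ℂ), ∀ i ∈ s, f i (y + t • v) ≠ 0 := by
          rw [Filter.eventually_all_finset]
          intro i hi
          have h3 : ContinuousAt (fun t : ℂ => f i (y + t • v)) 0 :=
            ((f i).continuous.comp hline).continuousAt
          refine h3.eventually_ne ?_
          rw [zero_smul, add_zero]
          exact hy i hi
        filter_upwards [mem_nhdsWithin_of_mem_nhds hev, self_mem_nhdsWithin] with t ht ht0
        have e : f l (y + t • v) = t := by simp [hly, hv]
        have := hsum (y + t • v) ht (by rw [e]; exact ht0)
        rw [e] at this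
        exact this)
    simpa using hp
  by_cases hj : j = 0
  · subst hj
    refine h0 (fun a => c (a + Finsupp.single l 0)) ?_
    intro w hw
    by_cases hlw : f l w = 0
    · exact hker w hw hlw
    · have := hsum w hw hlw
      simpa using this
  · refine h1 j hj (fun a => c (a + Finsupp.single l j)) ?_
    intro y hy
    exact hker y.1 hy (kr_apply _ y)

lemma sum_choose (q d : ℕ) : ∑ m ∈ Finset.range q, m.choose d = q.choose (d + 1) := by
  induction q with
  | zero => simp
  | succ q ih => rw [Finset.sum_range_succ, ih, Nat.choose_succ_succ, add_comm]

/-- The counting statement. -/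
def Cnt {W κ : Type} [NormedAddCommGroup W] [NormedSpace ℂ W]
    (f : κ → W →L[ℂ] ℂ) (s : Finset κ) (d : ℕ) (χ : ℤ) (q : ℕ) : Prop :=
  ∃ B : Finset (κ →₀ ℕ), (∀ a ∈ B, a.support ⊆ s ∧ a.degree = q + 1) ∧ Ind f s B ∧
    (-1) ^ d * χ * (q.choose d : ℤ) ≤ B.card

lemma Cnt.zero {W κ : Type} [NormedAddCommGroup W] [NormedSpace ℂ W]
    (f : κ → W →L[ℂ] ℂ) (s : Finset κ) (d : ℕ) (q : ℕ) : Cnt f s d 0 q :=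
  ⟨∅, by simp, fun c _ a ha => absurd ha (Finset.notMem_empty a), by simp⟩

lemma finrank_kr {W : Type} [NormedAddCommGroup W] [NormedSpace ℂ W] [FiniteDimensional ℂ W]
    (l : W →L[ℂ] ℂ) (hl : l ≠ 0) (d : ℕ) (hd : Module.finrank ℂ W = d + 1) :
    Module.finrank ℂ (kr l) = d := by
  have h : l.toLinearMap ≠ 0 := fun h => hl (by ext w; exact LinearMap.congr_fun h w)
  have := Module.Dual.finrank_ker_add_one_of_ne_zero h
  have h2 : Module.finrank ℂ (kr l) + 1 = Module.finrank ℂ W := this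
  omega

lemma count_base {W κ : Type} [NormedAddCommGroup W] [NormedSpace ℂ W] [FiniteDimensional ℂ W]
    (x0 : W →L[ℂ] ℂ) (f : κ → W →L[ℂ] ℂ) (s : Finset κ)
    (hd : Module.finrank ℂ W = 1) (hx : x0 ≠ 0) (hs : ∀ w, (∀ i ∈ s, f i w = 0) → w = 0)
    (χ : ℤ) (hχ : HC (XS x0 f s) χ) (q : ℕ) : Cnt f s 0 χ q := by
  obtain ⟨u, hu⟩ : ∃ u, x0 u ≠ 0 := by
    by_contra h
    push Not at h
    exact hx (by ext w; simpa using h w)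
  have hu0 : u ≠ 0 := fun h => hu (by rw [h, map_zero])
  by_cases hne : (XS x0 f s).Nonempty
  · obtain ⟨w, hw⟩ := hne
    have huniq : ∀ z ∈ XS x0 f s, z = w := by
      intro z hz
      obtain ⟨c, hc⟩ := (finrank_eq_one_iff_of_nonzero' u hu0).1 hd (z - w)
      have h1 : x0 (z - w) = 0 := by
        rw [map_sub, show x0 z = 1 from hz.1, show x0 w = 1 from hw.1, sub_self]
      rw [← hc, map_smul, smul_eq_mul] at h1
      have : c = 0 := (mul_eq_zero.1 h1).resolve_right hu
      rw [this, zero_smul] at hc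
      exact sub_eq_zero.1 hc.symm
    have : Unique (XS x0 f s) := ⟨⟨⟨w, hw⟩⟩, fun z => Subtype.ext (huniq z.1 z.2)⟩
    have h1 : HC (XS x0 f s) 1 :=
      HC.unit.of_homeo (Homeomorph.homeomorphOfUnique Unit (XS x0 f s))
    have : χ = 1 := hχ.unique h1
    subst this
    obtain ⟨i, hi⟩ : ∃ i, i ∈ s := by
      by_contra h
      push Not at h
      exact hu0 (hs u fun i hi => absurd hi (h i))
    refine ⟨{Finsupp.single i (q + 1)}, ?_, ?_, by simp⟩
    · intro a ha
      rw [Finset.mem_singleton.1 ha]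
      refine ⟨Finsupp.support_single_subset.trans (Finset.singleton_subset_iff.2 hi), ?_⟩
      rw [Finsupp.degree_single]
    · intro c hc a ha
      have := hc w hw.2
      rw [Finset.sum_singleton] at this
      rw [Finset.mem_singleton.1 ha]
      refine (mul_eq_zero.1 this).resolve_right ?_
      exact Finset.prod_ne_zero_iff.2 fun j hj => pow_ne_zero _ (inv_ne_zero (hw.2 j hj))
  · have : IsEmpty (XS x0 f s) := ⟨fun x => hne ⟨x.1, x.2⟩⟩
    have : χ = 0 := hχ.unique HC.empty
    subst this
    exact Cnt.zero f s 0 q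

lemma count_glue {W κ : Type} [NormedAddCommGroup W] [NormedSpace ℂ W] [DecidableEq κ]
    (f : κ → W →L[ℂ] ℂ) (s : Finset κ) (l : κ) (hl : l ∉ s) (v : W) (hv : f l v = 1)
    (d : ℕ) (a b : ℤ) (q : ℕ) (h1 : Cnt f s (d + 1) a q)
    (h2 : ∀ m, Cnt (fun i => rs (f l) (f i)) s d b m) : Cnt f (insert l s) (d + 1) (a - b) q := by
  obtain ⟨B', hB1, hB2, hB3⟩ := h1
  choose B'' hC1 hC2 hC3 using h2
  let Bs : ℕ → Finset (κ →₀ ℕ) := fun j => if j = 0 then B' else B'' (q - j)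
  have hBs0 : Bs 0 = B' := rfl
  have hBs : ∀ j, j ≠ 0 → Bs j = B'' (q - j) := fun j hj => if_neg hj
  have hsupp : ∀ j, ∀ a ∈ Bs j, a.support ⊆ s := by
    intro j a ha
    by_cases hj : j = 0
    · subst hj
      exact (hB1 a ha).1
    · rw [hBs j hj] at ha
      exact (hC1 _ a ha).1
  have hal : ∀ j, ∀ a ∈ Bs j, a l = 0 := fun j a ha => by
    by_contra h
    exact hl (hsupp j a ha (Finsupp.mem_support_iff.2 h))
  refine ⟨Bb l Bs q, ?_, ?_, ?_⟩
  · intro a ha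
    obtain ⟨j, hj, ha⟩ := Finset.mem_biUnion.1 ha
    obtain ⟨c, hc, rfl⟩ := Finset.mem_image.1 ha
    have hj : j ≤ q := Nat.lt_succ_iff.1 (Finset.mem_range.1 hj)
    refine ⟨?_, ?_⟩
    · refine Finsupp.support_add.trans (Finset.union_subset ?_ ?_)
      · exact (hsupp j c hc).trans (Finset.subset_insert _ _)
      · exact Finsupp.support_single_subset.trans
          (Finset.singleton_subset_iff.2 (Finset.mem_insert_self _ _))
    · rw [map_add, Finsupp.degree_single]
      by_cases hj0 : j = 0
      · subst hj0
        rw [(hB1 c hc).2]; 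
      · rw [hBs j hj0] at hc
        rw [(hC1 _ c hc).2]
        omega
  · refine ind_step f s l hl v hv Bs q hal hB2 ?_
    intro j hj
    rw [hBs j hj]
    exact hC2 _
  · have hcard : (Bb l Bs q).card = ∑ j ∈ Finset.range (q + 1), (Bs j).card := by
      have := Bb_sum l Bs q hal (fun _ => 1)
      simpa using this
    rw [hcard, Finset.sum_range_succ', hBs0]
    have h3 : ∀ j ∈ Finset.range q, (Bs (j + 1)).card = (B'' (q - 1 - j)).card := by
      intro j _
      rw [hBs (j + 1) (by omega)]
      congr 2
      omega
    rw [Finset.sum_congr rfl h3, Finset.sum_range_reflect (fun m => (B'' m).card) q]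
    have h4 : ∑ m ∈ Finset.range q, (-1) ^ d * b * (m.choose d : ℤ) ≤
        ∑ m ∈ Finset.range q, ((B'' m).card : ℤ) := Finset.sum_le_sum fun m _ => hC3 m
    rw [← Finset.mul_sum, ← Nat.cast_sum, sum_choose] at h4
    push_cast
    have e : (-1 : ℤ) ^ (d + 1) * (a - b) * (q.choose (d + 1) : ℤ) =
      (-1) ^ d * b * (q.choose (d + 1) : ℤ) + (-1) ^ (d + 1) * a * (q.choose (d + 1) : ℤ) := by ring
    rw [e]
    exact add_le_add h4 hB3

theorem count {κ : Type} [DecidableEq κ] (s : Finset κ) :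
    ∀ {W : Type} [NormedAddCommGroup W] [NormedSpace ℂ W] [FiniteDimensional ℂ W]
    (x0 : W →L[ℂ] ℂ) (f : κ → W →L[ℂ] ℂ) (d : ℕ),
    Module.finrank ℂ W = d + 1 → x0 ≠ 0 → (∀ w, (∀ i ∈ s, f i w = 0) → w = 0) →
    ∀ (χ : ℤ), HC (XS x0 f s) χ → ∀ q : ℕ, Cnt f s d χ q := by
  induction s using Finset.strongInduction with
  | H s ih =>
  intro W _ _ _ x0 f d hd hx hs χ hχ q
  cases d with
  | zero => exact count_base x0 f s hd hx hs χ hχ q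
  | succ d =>
  have hkx := finrank_kr x0 hx _ hd
  obtain ⟨l, hl, v, hv, hxv⟩ : ∃ l ∈ s, ∃ v, f l v = 1 ∧ x0 v = 0 := by
    by_contra h
    push Not at h
    have : Nontrivial (kr x0) := Module.nontrivial_of_finrank_pos (R := ℂ) (by omega)
    obtain ⟨y, hy⟩ := exists_ne (0 : kr x0)
    refine hy (Subtype.ext (hs y.1 fun i hi => ?_))
    rcases dichotomy x0 (f i) with ⟨c, hc⟩ | ⟨v, hv, hxv⟩
    · rw [hc]
      simp [kr_apply]
    · exact absurd hxv (h i hi v hv)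
  obtain ⟨s', hls', rfl⟩ : ∃ s', l ∉ s' ∧ s = insert l s' :=
    ⟨s.erase l, Finset.notMem_erase l s, (Finset.insert_erase hl).symm⟩
  have hss : s' ⊂ insert l s' := Finset.ssubset_insert hls'
  have hfl : f l ≠ 0 := fun h => by rw [h] at hv; simp at hv
  have hkl := finrank_kr (f l) hfl _ hd
  obtain ⟨a, ha⟩ := HC.exists_arr s' x0 f
  obtain ⟨b, hb⟩ := HC.exists_arr s' (rs (f l) x0) (fun i => rs (f l) (f i))
  have hχ' : χ = a - b := hχ.unique (HC.delres x0 f s' l v hv hxv ha hb)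
  -- the restriction
  have hrest : ∀ m, Cnt (fun i => rs (f l) (f i)) s' d b m := by
    refine ih s' hss (rs (f l) x0) (fun i => rs (f l) (f i)) d hkl ?_ ?_ b hb
    · intro h0
      apply hx
      rcases dichotomy (f l) x0 with ⟨c, hc⟩ | ⟨u, hu, hlu⟩
      · have : c = 0 := by
          have h := congrArg (fun g => g v) hc
          simpa [hv, hxv] using h.symm
        rw [hc, this]; ext w; simp
      · have := congrArg (fun g => g ⟨u, hlu⟩) h0
        have h2 : x0 u = 0 := this
        rw [hu] at h2
        exact absurd h2 one_ne_zero
    · intro w hw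
      refine Subtype.ext (hs w.1 fun i hi => ?_)
      rcases Finset.mem_insert.1 hi with rfl | hi
      · exact kr_apply _ w
      · exact hw i hi
  by_cases hco : ∀ w, (∀ i ∈ s', f i w = 0) → w = 0
  · rw [hχ']
    exact count_glue f s' l hls' v hv d a b q (ih s' hss x0 f (d + 1) hd hx hco a ha q) hrest
  · push Not at hco
    obtain ⟨u, hu, hu0⟩ := hco
    have hlu : f l u ≠ 0 := fun h => hu0 (hs u fun i hi => by
      rcases Finset.mem_insert.1 hi with rfl | hi
      · exact h
      · exact hu i hi)
    by_cases hxu : x0 u = 0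
    · have h0 : HC (XS x0 f (insert l s')) 0 := HC.coloop1 x0 f s' l ((f l u)⁻¹ • u)
        (by simp [hlu]) (by simp [hxu]) (fun i hi => by simp [hu i hi])
      rw [hχ.unique h0]
      exact Cnt.zero _ _ _ _
    · obtain ⟨j, hj⟩ : ∃ j, j ∈ s' := by
        by_contra h
        push Not at h
        have : Nontrivial (kr (f l)) := Module.nontrivial_of_finrank_pos (R := ℂ) (by omega)
        obtain ⟨y, hy⟩ := exists_ne (0 : kr (f l))
        refine hy (Subtype.ext (hs y.1 fun i hi => ?_))
        rcases Finset.mem_insert.1 hi with rfl | hi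
        · exact kr_apply _ y
        · exact absurd hi (h i)
      have h0 : HC (XS x0 f s') 0 := HC.coloop2 x0 f s' ((x0 u)⁻¹ • u)
        (by simp [hxu]) (fun i hi => by simp [hu i hi]) j hj
      rw [hχ', ha.unique h0]
      exact count_glue f s' l hls' v hv d 0 b q (Cnt.zero _ _ _ _) hrest

/-- Comparison of leading coefficients. -/
lemma lead_compare (d k : ℕ) (b : ℤ) (P : Polynomial ℚ) (hP : P.degree = (d : WithBot ℕ))
    (hl : P.leadingCoeff = (k : ℚ) / (Nat.factorial d : ℚ)) (N : ℕ)
    (h : ∀ q : ℕ, N ≤ q → (b : ℚ) * (q.choose d : ℚ) ≤ P.eval ((q : ℚ) + 1)) : b ≤ k := by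
  have hnd : P.natDegree = d := Polynomial.natDegree_eq_of_degree_eq_some hP
  have hP0 : P ≠ 0 := by
    rintro rfl
    simp at hP
  have hX : (Polynomial.X + Polynomial.C (1 : ℚ)).natDegree = 1 := Polynomial.natDegree_X_add_C 1
  have hQl : (P.comp (Polynomial.X + Polynomial.C 1)).leadingCoeff = P.leadingCoeff := by
    rw [Polynomial.leadingCoeff_comp (by rw [hX]; exact one_ne_zero),
      Polynomial.leadingCoeff_X_add_C, one_pow, mul_one]
  have hQ0 : P.comp (Polynomial.X + Polynomial.C 1) ≠ 0 := by
    rw [← Polynomial.leadingCoeff_ne_zero, hQl]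
    exact Polynomial.leadingCoeff_ne_zero.2 hP0
  have hQd : (P.comp (Polynomial.X + Polynomial.C 1)).degree = (descPochhammer ℚ d).degree := by
    rw [Polynomial.degree_eq_natDegree hQ0, Polynomial.natDegree_comp, hX, hnd,
      Polynomial.degree_eq_natDegree (monic_descPochhammer ℚ d).ne_zero, descPochhammer_natDegree,
      mul_one]
  have ht := Polynomial.div_tendsto_atTop_leadingCoeff_div_of_degree_eq _ _ hQd
  rw [hQl, (monic_descPochhammer ℚ d).leadingCoeff, div_one, hl] at ht
  have ht2 := ht.comp (tendsto_natCast_atTop_atTop (R := ℚ))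
  have hf : (0 : ℚ) < (Nat.factorial d : ℚ) := by exact_mod_cast Nat.factorial_pos d
  have hge : (b : ℚ) / (Nat.factorial d : ℚ) ≤ (k : ℚ) / (Nat.factorial d : ℚ) := by
    refine ge_of_tendsto ht2 ?_
    filter_upwards [Filter.eventually_ge_atTop (max N d)] with q hq
    have hqN : N ≤ q := le_trans (le_max_left _ _) hq
    have hqd : d ≤ q := le_trans (le_max_right _ _) hq
    have hc := h q hqN
    have hpos : (0 : ℚ) < (q.descFactorial d : ℚ) := by
      exact_mod_cast Nat.descFactorial_pos.2 hqd
    have he : (q.descFactorial d : ℚ) = (Nat.factorial d : ℚ) * (q.choose d : ℚ) := by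
      exact_mod_cast Nat.descFactorial_eq_factorial_mul_choose q d
    simp only [Function.comp_apply, descPochhammer_eval_eq_descFactorial, Polynomial.eval_comp,
      Polynomial.eval_add, Polynomial.eval_X, Polynomial.eval_C]
    rw [div_le_div_iff₀ hf hpos, he]
    nlinarith
  have h2 : (b : ℚ) ≤ (k : ℚ) := (div_le_div_iff_of_pos_right hf).1 hge
  exact_mod_cast h2

/-- The linear form attached to a column of `L`. -/
def colForm {e m : ℕ} (L : Matrix (Fin (e+1)) (Fin (m+1)) ℂ) (i : Fin (m+1)) :
    (Fin (e+1) → ℂ) →L[ℂ] ℂ :=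
  ∑ r : Fin (e+1), L r i • (ContinuousLinearMap.proj r : (Fin (e+1) → ℂ) →L[ℂ] ℂ)

lemma colForm_apply {e m : ℕ} (L : Matrix (Fin (e+1)) (Fin (m+1)) ℂ) (i : Fin (m+1))
    (w : Fin (e+1) → ℂ) : colForm L i w = ∑ r, w r * L r i := by
  simp [colForm, mul_comm]

lemma colForm_cons {e m : ℕ} (L : Matrix (Fin (e+1)) (Fin (m+1)) ℂ) (i : Fin (m+1))
    (x : Fin e → ℂ) : colForm L i (Fin.cons 1 x) = ell ℂ L x i := by
  rw [colForm_apply, Fin.sum_univ_succ]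
  simp [ell]

/-- The coordinate at infinity. -/
def x0c (e : ℕ) : (Fin (e+1) → ℂ) →L[ℂ] ℂ := ContinuousLinearMap.proj 0

lemma x0c_apply (e : ℕ) (w : Fin (e+1) → ℂ) : x0c e w = w 0 := rfl

/-- The complement as an affine slice. -/
def sliceHomeo {e m : ℕ} (L : Matrix (Fin (e+1)) (Fin (m+1)) ℂ) :
    XS (x0c e) (colForm L) Finset.univ ≃ₜ complementX L where
  toFun w := ⟨fun j => w.1 j.succ, by
    intro i
    have h0 : w.1 0 = 1 := w.2.1
    have : (Fin.cons 1 (fun j => w.1 j.succ) : Fin (e+1) → ℂ) = w.1 := by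
      funext r
      refine Fin.cases ?_ (fun j => ?_) r
      · simp [h0]
      · simp
    rw [← colForm_cons, this]
    exact w.2.2 i (Finset.mem_univ i)⟩
  invFun x := ⟨Fin.cons 1 x.1, by
    refine ⟨by simp [x0c_apply], fun i _ => ?_⟩
    rw [colForm_cons]
    exact x.2 i⟩
  left_inv w := by
    apply Subtype.ext
    have h0 : w.1 0 = 1 := w.2.1
    funext r
    refine Fin.cases ?_ (fun j => ?_) r
    · simp [h0]
    · simp
  right_inv x := by
    apply Subtype.ext
    funext j
    simp
  continuous_toFun := by
    refine Continuous.subtype_mk ?_ _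
    exact continuous_pi fun j => (continuous_apply j.succ).comp continuous_subtype_val
  continuous_invFun := by
    refine Continuous.subtype_mk ?_ _
    refine continuous_pi fun r => ?_
    refine Fin.cases ?_ (fun j => ?_) r
    · simpa using continuous_const
    · simp only [Fin.cons_succ]
      exact (continuous_apply j).comp continuous_subtype_val

lemma colForm_ker {e m : ℕ} (L : Matrix (Fin (e+1)) (Fin (m+1)) ℂ) (hrank : L.rank = e + 1)
    (w : Fin (e+1) → ℂ) (hw : ∀ i, colForm L i w = 0) : w = 0 := by
  have hli : LinearIndependent ℂ L.row := by
    rw [linearIndependent_iff_card_eq_finrank_span]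
    rw [Matrix.rank_eq_finrank_span_row] at hrank
    rw [Fintype.card_fin]
    exact hrank.symm
  have hinj := Matrix.vecMul_injective_iff.2 hli
  apply hinj
  funext i
  simp only [Matrix.zero_vecMul]
  have := hw i
  rw [colForm_apply] at this
  simpa [Matrix.vecMul, dotProduct] using this

lemma mon_smul {W κ : Type} [NormedAddCommGroup W] [NormedSpace ℂ W] [Fintype κ]
    (f : κ → W →L[ℂ] ℂ) (a : κ →₀ ℕ) (t : ℂ) (w : W) :
    mon f Finset.univ a (t • w) = (t⁻¹) ^ a.degree * mon f Finset.univ a w := by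
  unfold mon
  simp only [map_smul, smul_eq_mul, mul_inv, mul_pow]
  rw [Finset.prod_mul_distrib, Finset.prod_pow_eq_pow_sum, Finsupp.degree_eq_sum]

/-- Relations on the affine chart extend to the full complement of the central arrangement. -/
lemma rel_extend {e m : ℕ} (L : Matrix (Fin (e+1)) (Fin (m+1)) ℂ) (q : ℕ)
    (B : Finset (Fin (m+1) →₀ ℕ)) (hB : ∀ a ∈ B, a.degree = q) (c : (Fin (m+1) →₀ ℕ) → ℂ)
    (h : ∀ w, w 0 = 1 → (∀ i, colForm L i w ≠ 0) →
      ∑ a ∈ B, c a * mon (colForm L) Finset.univ a w = 0) :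
    ∀ w, (∀ i, colForm L i w ≠ 0) → ∑ a ∈ B, c a * mon (colForm L) Finset.univ a w = 0 := by
  have h1 : ∀ w : Fin (e+1) → ℂ, w 0 ≠ 0 → (∀ i, colForm L i w ≠ 0) →
      ∑ a ∈ B, c a * mon (colForm L) Finset.univ a w = 0 := by
    intro w hw0 hw
    have h2 := h ((w 0)⁻¹ • w) (by simp [hw0]) (fun i => by simp [hw0, hw i])
    have h3 : ∑ a ∈ B, c a * mon (colForm L) Finset.univ a ((w 0)⁻¹ • w) =
        (w 0) ^ q * ∑ a ∈ B, c a * mon (colForm L) Finset.univ a w := by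
      rw [Finset.mul_sum]
      refine Finset.sum_congr rfl fun a ha => ?_
      rw [mon_smul, hB a ha, inv_inv]
      ring
    rw [h3] at h2
    exact (mul_eq_zero.1 h2).resolve_left (pow_ne_zero _ hw0)
  intro w hw
  by_cases hw0 : w 0 = 0
  · have hcont : ContinuousAt (fun t : ℂ => w + t • (Pi.single 0 1 : Fin (e+1) → ℂ)) 0 := by
      fun_prop
    have hev : ∀ᶠ t in nhds (0 : ℂ), ∀ i, colForm L i
        (w + t • (Pi.single 0 1 : Fin (e+1) → ℂ)) ≠ 0 := by
      rw [Filter.eventually_all]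
      intro i
      have hc : ContinuousAt (fun t : ℂ => colForm L i
          (w + t • (Pi.single 0 1 : Fin (e+1) → ℂ))) 0 :=
        (colForm L i).continuous.continuousAt.comp hcont
      exact hc.eventually_ne (by simpa using hw i)
    have hS : ContinuousAt (fun w => ∑ a ∈ B, c a * mon (colForm L) Finset.univ a w) w := by
      refine tendsto_finsetSum _ fun a _ => ?_
      exact continuousAt_const.mul (mon_contAt _ _ _ _ fun i _ => hw i)
    have hS2 : Filter.Tendsto (fun t : ℂ => ∑ a ∈ B, c a * mon (colForm L) Finset.univ a
        (w + t • (Pi.single 0 1 : Fin (e+1) → ℂ))) (nhdsWithin 0 {0}ᶜ)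
        (nhds (∑ a ∈ B, c a * mon (colForm L) Finset.univ a w)) := by
      have h4 : Filter.Tendsto (fun t : ℂ => w + t • (Pi.single 0 1 : Fin (e+1) → ℂ))
          (nhds 0) (nhds w) := by
        have := hcont.tendsto
        simpa using this
      exact (hS.tendsto.comp h4).mono_left nhdsWithin_le_nhds
    refine tendsto_nhds_unique hS2 ?_
    refine tendsto_const_nhds.congr' ?_
    filter_upwards [nhdsWithin_le_nhds hev, self_mem_nhdsWithin] with t ht ht0
    exact (h1 _ (by simpa [hw0] using ht0) ht).symm
  · exact h1 w hw0 hw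

/-- A family of reciprocal monomials that is independent bounds the Hilbert function below. -/
lemma card_le_hilb {e m : ℕ} (L : Matrix (Fin (e+1)) (Fin (m+1)) ℂ) (q : ℕ)
    (B : Finset (Fin (m+1) →₀ ℕ)) (hB : ∀ a ∈ B, a.degree = q)
    (hI : Ind (colForm L) Finset.univ B) :
    B.card ≤ hilb ℂ (vanishingIdeal ℂ (coneImage L)) q := by
  set I := vanishingIdeal ℂ (coneImage L) with hIdef
  have hfin : Module.Finite ℂ (MvPolynomial.homogeneousSubmodule (Fin (m+1)) ℂ q) := by
    have hf : {a : Fin (m+1) →₀ ℕ | a.degree ≤ q}.Finite := Finsupp.finite_of_degree_le q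
    have hle : MvPolynomial.homogeneousSubmodule (Fin (m+1)) ℂ q ≤ Submodule.span ℂ
        ((fun a => MvPolynomial.monomial a (1 : ℂ)) '' {a : Fin (m+1) →₀ ℕ | a.degree ≤ q}) := by
      intro p hp
      rw [MvPolynomial.mem_homogeneousSubmodule] at hp
      rw [← MvPolynomial.support_sum_monomial_coeff p]
      refine Submodule.sum_mem _ fun a ha => ?_
      have h1 : MvPolynomial.monomial a (p.coeff a) =
          p.coeff a • MvPolynomial.monomial a (1 : ℂ) := by
        rw [MvPolynomial.smul_monomial, smul_eq_mul, mul_one]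
      rw [h1]
      refine Submodule.smul_mem _ _ (Submodule.subset_span ⟨a, ?_, rfl⟩)
      have h2 := hp (MvPolynomial.mem_support_iff.1 ha)
      have h3 : a.degree = q := by
        rw [← h2, Finsupp.degree_eq_weight_one]
        rfl
      exact le_of_eq h3
    have := FiniteDimensional.span_of_finite ℂ (hf.image fun a => MvPolynomial.monomial a (1 : ℂ))
    exact Submodule.finiteDimensional_of_le hle
  have hmem : ∀ a : B, (Ideal.Quotient.mkₐ ℂ I).toLinearMap (MvPolynomial.monomial a.1 1) ∈
      (MvPolynomial.homogeneousSubmodule (Fin (m+1)) ℂ q).map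
        (Ideal.Quotient.mkₐ ℂ I).toLinearMap := by
    intro a
    refine Submodule.mem_map_of_mem ?_
    rw [MvPolynomial.mem_homogeneousSubmodule]
    exact MvPolynomial.isHomogeneous_monomial _ (hB a.1 a.2)
  have hli : LinearIndependent ℂ (fun a : B => (⟨_, hmem a⟩ :
      (MvPolynomial.homogeneousSubmodule (Fin (m+1)) ℂ q).map
        (Ideal.Quotient.mkₐ ℂ I).toLinearMap)) := by
    rw [Fintype.linearIndependent_iff]
    intro g hg a
    have hg2 := congrArg Subtype.val hg
    simp only [Submodule.coe_sum, Submodule.coe_smul, Submodule.coe_zero] at hg2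
    have hg3 : (∑ a : B, g a • MvPolynomial.monomial a.1 (1 : ℂ)) ∈ I := by
      have h1 : (Ideal.Quotient.mkₐ ℂ I).toLinearMap
          (∑ a : B, g a • MvPolynomial.monomial a.1 (1 : ℂ)) = 0 := by
        rw [map_sum, ← hg2]
        exact Finset.sum_congr rfl fun a _ => LinearMap.map_smul _ _ _
      exact Ideal.Quotient.eq_zero_iff_mem.1 h1
    classical
    let c : (Fin (m+1) →₀ ℕ) → ℂ := fun a => if h : a ∈ B then g ⟨a, h⟩ else 0
    have hc := hI c ?_ a.1 a.2
    · simpa [c] using hc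
    · intro w hw
      refine rel_extend L q B hB c ?_ w (fun i => hw i (Finset.mem_univ i))
      intro w hw0 hw
      have hcons : (Fin.cons 1 (fun j => w j.succ) : Fin (e+1) → ℂ) = w := by
        funext r
        refine Fin.cases ?_ (fun j => ?_) r
        · simp [hw0]
        · simp
      have hell : ∀ i, ell ℂ L (fun j => w j.succ) i = colForm L i w := by
        intro i
        rw [← colForm_cons, hcons]
      have hev := hg3 (fun i => 1 / ell ℂ L (fun j => w j.succ) i)
        ⟨1, fun j => w j.succ, fun i => by rw [hell]; exact hw i, rfl⟩
      rw [map_sum] at hev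
      rw [← Finset.sum_coe_sort]
      rw [← hev]
      refine Finset.sum_congr rfl fun a _ => ?_
      simp only [c, a.2, dif_pos, Subtype.coe_eta, hell, MvPolynomial.smul_eval,
        MvPolynomial.eval_monomial, one_mul, one_div]
      congr 1
      rw [Finsupp.prod_fintype _ _ (by simp)]
      rfl
  have := hli.fintype_card_le_finrank
  simpa [hilb] using this

theorem main_aux {e m : ℕ} (L : Matrix (Fin (e+1)) (Fin (m+1)) ℂ)
    (hrank : L.rank = e + 1) (k : ℕ)
    (hk : IsProjDegree ℂ (vanishingIdeal ℂ (coneImage L)) e k) :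
    (-1) ^ e * eulerChar ↥(complementX L) ≤ (k : ℤ) := by
  obtain ⟨χ, hχ⟩ := HC.exists_arr (Finset.univ : Finset (Fin (m+1))) (x0c e) (colForm L)
  have hχ2 : eulerChar ↥(complementX L) = χ :=
    HasChi.eulerChar_eq (HC.of_homeo (sliceHomeo L) hχ)
  rw [hχ2]
  obtain ⟨P, ⟨N, hN⟩, hdeg, hlead⟩ := hk
  refine lead_compare e k _ P hdeg hlead N fun q hq => ?_
  have hx0 : x0c e ≠ 0 := by
    intro h
    have := congrArg (fun g => g (Pi.single 0 1)) h
    simp [x0c_apply] at this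
  obtain ⟨B, hB1, hB2, hB3⟩ := count Finset.univ (x0c e) (colForm L) e (by simp) hx0
    (fun w hw => colForm_ker L hrank w fun i => hw i (Finset.mem_univ i)) χ hχ q
  have h1 := card_le_hilb L (q + 1) B (fun a ha => (hB1 a ha).2) hB2
  have h2 := hN (q + 1) (by omega)
  push_cast at h2
  rw [h2]
  have h3 : (-1) ^ e * χ * (q.choose e : ℤ) ≤
      ((hilb ℂ (vanishingIdeal ℂ (coneImage L)) (q + 1) : ℕ) : ℤ) :=
    hB3.trans (by exact_mod_cast h1)
  exact_mod_cast h3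

/-- Proposition 2.5.  If `rank L = d+1`, then
`(-1)^d ⋅ χ(X) ≤ deg ℛ_L`. -/
theorem signed_euler_le_reciprocal_degree
    {d n : ℕ} (L : Matrix (Fin (d+1)) (Fin (n+1)) ℂ)
    (hrank : L.rank = d + 1) :
    ∀ k : ℕ, IsProjDegree ℂ (vanishingIdeal ℂ (coneImage L)) d k →
      (-1) ^ d * eulerChar ↥(complementX L) ≤ (k : ℤ) := by
  intro k hk
  exact main_aux L hrank k hk

end ScatteringPaper
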